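/- arXiv:2603.16837 — 8 statements merged into one kernel-verified Lean document; each statement's English description precedes it below -/
import Mathlib

section
/- Let ν ≥ 1 and let Û : ℝ → M_ν(ℂ) have analytic entries, with Û(θ) normal for every θ and Û(θ+1) = Û(θ) for all θ. Let E_1,…,E_ν be an analytic eigenvalue selection for Û, and assume Û has no flat band, i.e. no E_i is a constant function. Then there exists a strictly increasing sequence of positive integers (N_n) such that for all s, w ∈ {1,…,ν}, the quantity (max over m ∈ {1,…,N_n − 1} of #{r ∈ {0,…,N_n − 1} : E_s((r+m)/N_n) = E_w(r/N_n)}) / N_n tends to 0 as n → ∞; that is, the No Repeating Graphs condition holds along a subsequence. -/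
open Filter

noncomputable section

/-- A real-analytic function on `ℝ` that is not identically zero has finitely many zeros in a
compact set. -/
theorem finite_zeros_of_analytic {F : Type*} [NormedAddCommGroup F] [NormedSpace ℝ F]
    {f : ℝ → F} (hf : ∀ x, AnalyticAt ℝ f x) (hne : ∃ x, f x ≠ 0) {K : Set ℝ}
    (hK : IsCompact K) : {x ∈ K | f x = 0}.Finite := by
  by_contra hinf
  obtain ⟨a, -, ha⟩ := Set.Infinite.exists_accPt_of_subset_isCompact hinf hK
    (Set.sep_subset K _)
  rw [accPt_iff_frequently_nhdsNE] at ha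
  have hfreq : ∃ᶠ y in nhdsWithin a {a}ᶜ, f y = (fun _ => (0 : F)) y :=
    ha.mono fun y hy => hy.2
  have heq := AnalyticOnNhd.eq_of_frequently_eq (f := f) (g := fun _ => (0 : F))
    (fun x _ => hf x) (fun x _ => analyticAt_const) hfreq
  obtain ⟨x, hx⟩ := hne
  exact hx (congrFun heq x)

/-- Small translates `f (x + δ)` of a nonconstant real-analytic `f : ℝ → ℝ` agree with `f x` only
near a finite set of critical points. -/
theorem near_finite_of_real_translate_eq {f : ℝ → ℝ} (hf : ∀ x, AnalyticAt ℝ f x)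
    (hne : ¬ ∃ c, ∀ x, f x = c) :
    ∃ S : Finset ℝ, ∀ η > 0, ∀ δ : ℝ, δ ≠ 0 → |δ| < η → |δ| < 1 →
      ∀ x ∈ Set.Icc (0 : ℝ) 1, f (x + δ) = f x → ∃ p ∈ S, |x - p| ≤ η := by
  have hd : ∃ x, deriv f x ≠ 0 := by
    by_contra! h
    exact hne ⟨f 0, fun x => is_const_of_deriv_eq_zero
      (fun y => (hf y).differentiableAt) h x 0⟩
  have hfin := finite_zeros_of_analytic (fun x => (hf x).deriv) hd
    (isCompact_Icc (a := (-1 : ℝ)) (b := 2))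
  have hcont : Continuous f := continuous_iff_continuousAt.2 fun x => (hf x).continuousAt
  refine ⟨hfin.toFinset, fun η _ δ hδ hδη hδ1 x hx hfx => ?_⟩
  obtain ⟨h1, h2⟩ := abs_lt.1 hδη
  obtain ⟨h3, h4⟩ := abs_lt.1 hδ1
  obtain ⟨h5, h6⟩ := hx
  rcases lt_or_gt_of_ne hδ with hneg | hpos
  · obtain ⟨c, ⟨hc1, hc2⟩, hc⟩ := exists_deriv_eq_zero (f := f) (a := x + δ) (b := x)
      (by linarith) hcont.continuousOn hfx
    refine ⟨c, ?_, abs_le.2 ⟨by linarith, by linarith⟩⟩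
    rw [Set.Finite.mem_toFinset]
    exact ⟨⟨by linarith, by linarith⟩, hc⟩
  · obtain ⟨c, ⟨hc1, hc2⟩, hc⟩ := exists_deriv_eq_zero (f := f) (a := x) (b := x + δ)
      (by linarith) hcont.continuousOn hfx.symm
    refine ⟨c, ?_, abs_le.2 ⟨by linarith, by linarith⟩⟩
    rw [Set.Finite.mem_toFinset]
    exact ⟨⟨by linarith, by linarith⟩, hc⟩

/-- Complex-valued version of `near_finite_of_real_translate_eq`. -/
theorem near_finite_of_translate_eq {f : ℝ → ℂ} (hf : ∀ x, AnalyticAt ℝ f x)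
    (hne : ¬ ∃ c, ∀ x, f x = c) :
    ∃ S : Finset ℝ, ∀ η > 0, ∀ δ : ℝ, δ ≠ 0 → |δ| < η → |δ| < 1 →
      ∀ x ∈ Set.Icc (0 : ℝ) 1, f (x + δ) = f x → ∃ p ∈ S, |x - p| ≤ η := by
  have hre : ∀ x, AnalyticAt ℝ (fun y => (f y).re) x := fun x =>
    (Complex.reCLM.analyticAt _).comp (hf x)
  have him : ∀ x, AnalyticAt ℝ (fun y => (f y).im) x := fun x =>
    (Complex.imCLM.analyticAt _).comp (hf x)
  by_cases h : ∃ c, ∀ x, (f x).re = c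
  · have h' : ¬ ∃ c, ∀ x, (f x).im = c := by
      rintro ⟨d, hd⟩
      obtain ⟨c, hc⟩ := h
      exact hne ⟨⟨c, d⟩, fun x => Complex.ext (hc x) (hd x)⟩
    obtain ⟨S, hS⟩ := near_finite_of_real_translate_eq him h'
    exact ⟨S, fun η hη δ h1 h2 h3 x hx hfx => hS η hη δ h1 h2 h3 x hx (congrArg Complex.im hfx)⟩
  · obtain ⟨S, hS⟩ := near_finite_of_real_translate_eq hre h
    exact ⟨S, fun η hη δ h1 h2 h3 x hx hfx => hS η hη δ h1 h2 h3 x hx (congrArg Complex.re hfx)⟩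

/-- For shifts `α` close to, but different from, a given `α₀`, the coincidences
`f (x + α) = g x` in the unit interval lie near a fixed finite set. -/
theorem near_finite_of_shift_eq {f g : ℝ → ℂ} (hf : ∀ x, AnalyticAt ℝ f x)
    (hg : ∀ x, AnalyticAt ℝ g x) (hne : ¬ ∃ c, ∀ x, g x = c) (α₀ : ℝ) :
    ∃ S : Finset ℝ, ∀ η > 0, ∀ᶠ α in nhds α₀, α ≠ α₀ →
      ∀ x ∈ Set.Icc (0 : ℝ) 1, f (x + α) = g x → ∃ p ∈ S, |x - p| ≤ η := by
  by_cases h : ∀ x, f (x + α₀) = g x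
  · obtain ⟨S, hS⟩ := near_finite_of_translate_eq hg hne
    refine ⟨S, fun η hη => ?_⟩
    filter_upwards [Metric.ball_mem_nhds α₀ (lt_min hη one_pos)] with α hα hαne x hx hfx
    rw [Metric.mem_ball, Real.dist_eq, lt_min_iff] at hα
    refine hS η hη (α - α₀) (sub_ne_zero.2 hαne) hα.1 hα.2 x hx ?_
    rw [← h, ← hfx]
    congr 1
    ring
  · push Not at h
    obtain ⟨x₀, hx₀⟩ := h
    have hfin := finite_zeros_of_analytic (f := fun x => f (x + α₀) - g x)
      (fun x => ((hf (x + α₀)).comp_of_eq (f := fun y => y + α₀)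
        (analyticAt_id.add analyticAt_const) rfl).sub (hg x))
      ⟨x₀, sub_ne_zero.2 hx₀⟩ (isCompact_Icc (a := (0 : ℝ)) (b := 1))
    refine ⟨hfin.toFinset, fun η hη => ?_⟩
    have hfc : Continuous f := continuous_iff_continuousAt.2 fun x => (hf x).continuousAt
    have hgc : Continuous g := continuous_iff_continuousAt.2 fun x => (hg x).continuousAt
    have hcompact : IsCompact
        (Set.Icc (0 : ℝ) 1 \ ⋃ p ∈ hfin.toFinset, Metric.ball p η) :=
      isCompact_Icc.diff (isOpen_biUnion fun _ _ => Metric.isOpen_ball)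
    have hev := hcompact.eventually_forall_of_forall_eventually (x₀ := α₀)
      (P := fun α x => f (x + α) ≠ g x) (fun x hx => by
        have hopen : IsOpen {z : ℝ × ℝ | f (z.2 + z.1) ≠ g z.2} :=
          isOpen_ne_fun (by fun_prop) (by fun_prop)
        refine hopen.mem_nhds fun heq => hx.2 ?_
        refine Set.mem_biUnion (x := x) ?_ (Metric.mem_ball_self hη)
        simpa [sub_eq_zero] using And.intro hx.1 heq)
    filter_upwards [hev] with α hα _ x hx hfx
    by_contra! hfar
    refine hα x ⟨hx, ?_⟩ hfx
    simp only [Set.mem_iUnion, Metric.mem_ball, Real.dist_eq, not_exists, not_lt]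
    exact fun p hp => (hfar p hp).le

/-- The number of grid points `r / N` within distance `η` of a finite set `S`. -/
theorem ncard_grid_near_le (S : Finset ℝ) {η : ℝ} (hη : 0 < η) {N : ℕ} (hN : 0 < N) :
    (Set.ncard {r : Fin N | ∃ p ∈ S, |((r : ℕ) : ℝ) / N - p| ≤ η} : ℝ) ≤
      S.card * (2 * η * N + 1) := by
  classical
  have hN' : (0 : ℝ) < N := by exact_mod_cast hN
  let T : ℝ → Finset ℤ := fun p => Finset.Icc ⌈N * (p - η)⌉ ⌊N * (p + η)⌋
  have hT : ∀ p, ((T p).card : ℝ) ≤ 2 * η * N + 1 := by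
    intro p
    have h0 : (0 : ℝ) ≤ 2 * η * N + 1 := by positivity
    rw [Int.card_Icc]
    have h1 := Int.floor_le (N * (p + η))
    have h2 := Int.le_ceil (N * (p - η))
    rcases le_total 0 (⌊N * (p + η)⌋ + 1 - ⌈N * (p - η)⌉) with h | h
    · have h3 : (((⌊N * (p + η)⌋ + 1 - ⌈N * (p - η)⌉).toNat : ℤ) : ℝ) =
          ((⌊N * (p + η)⌋ + 1 - ⌈N * (p - η)⌉ : ℤ) : ℝ) := by rw [Int.toNat_of_nonneg h]
      rw [Int.cast_natCast] at h3
      rw [h3]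
      push_cast
      linarith
    · rw [Int.toNat_of_nonpos h]
      simpa using h0
  have hle : Set.ncard {r : Fin N | ∃ p ∈ S, |((r : ℕ) : ℝ) / N - p| ≤ η} ≤
      (S.biUnion T).card := by
    rw [← Set.ncard_coe_finset]
    refine Set.ncard_le_ncard_of_injOn (fun r : Fin N => ((r : ℕ) : ℤ)) ?_ ?_
      (Finset.finite_toSet _)
    · rintro r ⟨p, hp, hr⟩
      obtain ⟨h1, h2⟩ := abs_le.1 hr
      have hr' : (((r : ℕ) : ℝ) / N) * N = (r : ℕ) := div_mul_cancel₀ _ hN'.ne'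
      simp only [Finset.mem_coe, Finset.mem_biUnion]
      refine ⟨p, hp, Finset.mem_Icc.2 ⟨Int.ceil_le.2 ?_, Int.le_floor.2 ?_⟩⟩
      · push_cast
        nlinarith
      · push_cast
        nlinarith
    · intro a _ b _ hab
      exact Fin.ext (Int.natCast_inj.1 hab)
  calc _ ≤ ((S.biUnion T).card : ℝ) := by exact_mod_cast hle
    _ ≤ ∑ p ∈ S, ((T p).card : ℝ) := by exact_mod_cast Finset.card_biUnion_le
    _ ≤ ∑ _p ∈ S, (2 * η * N + 1) := Finset.sum_le_sum fun p _ => hT p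
    _ = _ := by rw [Finset.sum_const, nsmul_eq_mul]

/-- A given real number is a proper fraction `m / N` for at most one prime `N`. -/
theorem exists_forall_prime_div_ne (α : ℝ) :
    ∃ M : ℕ, ∀ N : ℕ, N.Prime → M < N → ∀ m : ℕ, 0 < m → m < N → (m : ℝ) / N ≠ α := by
  by_cases h : ∃ N m : ℕ, N.Prime ∧ 0 < m ∧ m < N ∧ (m : ℝ) / N = α
  · obtain ⟨P, k, hP, hk0, hkP, rfl⟩ := h
    refine ⟨P, fun N hN hPN m hm hmN heq => ?_⟩
    have hN0 : (N : ℝ) ≠ 0 := by exact_mod_cast hN.ne_zero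
    have hP0 : (P : ℝ) ≠ 0 := by exact_mod_cast hP.ne_zero
    rw [div_eq_div_iff hN0 hP0] at heq
    have heq' : m * P = k * N := by exact_mod_cast heq
    rcases hN.dvd_mul.1 (Dvd.intro_left k heq'.symm) with h | h
    · exact absurd (Nat.le_of_dvd hm h) (by omega)
    · exact absurd (Nat.le_of_dvd hP.pos h) (by omega)
  · push Not at h
    exact ⟨0, fun N hN _ m hm hmN => h N m hN hm hmN⟩

/-- Along primes `N`, the proportion of grid points with `f ((r + m) / N) = g (r / N)` is small,
uniformly in `0 < m < N`. -/
theorem exists_forall_prime_ncard_le {f g : ℝ → ℂ} (hf : ∀ x, AnalyticAt ℝ f x)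
    (hg : ∀ x, AnalyticAt ℝ g x) (hne : ¬ ∃ c, ∀ x, g x = c) {ε : ℝ} (hε : 0 < ε) :
    ∃ M : ℕ, ∀ N : ℕ, N.Prime → M < N → ∀ m : ℕ, 0 < m → m < N →
      (Set.ncard {r : Fin N | f ((((r : ℕ) + m : ℕ) : ℝ) / (N : ℝ)) =
        g (((r : ℕ) : ℝ) / (N : ℝ))} : ℝ) ≤ ε * N := by
  suffices H : ∃ M : ℕ, ∀ N : ℕ, N.Prime → M < N → ∀ m : ℕ, 0 < m → m < N →
      (m : ℝ) / N ∈ Set.Icc (0 : ℝ) 1 →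
      (Set.ncard {r : Fin N | f ((((r : ℕ) + m : ℕ) : ℝ) / (N : ℝ)) =
        g (((r : ℕ) : ℝ) / (N : ℝ))} : ℝ) ≤ ε * N by
    obtain ⟨M, hM⟩ := H
    refine ⟨M, fun N hN hMN m hm hmN => hM N hN hMN m hm hmN ⟨by positivity, ?_⟩⟩
    exact div_le_one_of_le₀ (by exact_mod_cast hmN.le) (by positivity)
  refine (isCompact_Icc (a := (0 : ℝ)) (b := 1)).induction_on
    (p := fun T => ∃ M : ℕ, ∀ N : ℕ, N.Prime → M < N → ∀ m : ℕ, 0 < m → m < N →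
      (m : ℝ) / N ∈ T →
      (Set.ncard {r : Fin N | f ((((r : ℕ) + m : ℕ) : ℝ) / (N : ℝ)) =
        g (((r : ℕ) : ℝ) / (N : ℝ))} : ℝ) ≤ ε * N) ?_ ?_ ?_ ?_
  · exact ⟨0, fun N _ _ m _ _ h => h.elim⟩
  · rintro s t hst ⟨M, hM⟩
    exact ⟨M, fun N hN hMN m hm hmN h => hM N hN hMN m hm hmN (hst h)⟩
  · rintro s t ⟨M, hM⟩ ⟨M', hM'⟩
    refine ⟨max M M', fun N hN hMN m hm hmN h => ?_⟩
    rw [max_lt_iff] at hMN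
    exact h.elim (hM N hN hMN.1 m hm hmN) (hM' N hN hMN.2 m hm hmN)
  · intro α₀ _
    obtain ⟨S, hS⟩ := near_finite_of_shift_eq hf hg hne α₀
    obtain ⟨M₁, hM₁⟩ := exists_forall_prime_div_ne α₀
    have hS0 : (0 : ℝ) < S.card + 1 := by positivity
    set η : ℝ := ε / (4 * (S.card + 1)) with hηdef
    have hη : 0 < η := by positivity
    obtain ⟨M₂, hM₂⟩ := exists_nat_gt (2 * (S.card : ℝ) / ε)
    refine ⟨_, mem_nhdsWithin_of_mem_nhds (hS η hη), max M₁ M₂,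
      fun N hN hMN m hm hmN hmem => ?_⟩
    rw [max_lt_iff] at hMN
    have hN0 : (0 : ℝ) < N := by exact_mod_cast hN.pos
    have hsub : {r : Fin N | f ((((r : ℕ) + m : ℕ) : ℝ) / (N : ℝ)) =
        g (((r : ℕ) : ℝ) / (N : ℝ))} ⊆
        {r : Fin N | ∃ p ∈ S, |((r : ℕ) : ℝ) / N - p| ≤ η} := by
      intro r hr
      refine hmem (hM₁ N hN hMN.1 m hm hmN) _ ⟨by positivity, ?_⟩ ?_
      · exact div_le_one_of_le₀ (by exact_mod_cast r.isLt.le) hN0.le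
      · rw [← add_div, ← Nat.cast_add]
        exact hr
    have hcard : S.card * (2 * η) ≤ ε / 2 := by
      rw [hηdef]
      field_simp
      nlinarith
    have hlarge : 2 * (S.card : ℝ) < ε * N := by
      rw [div_lt_iff₀ hε] at hM₂
      have : (M₂ : ℝ) < N := by exact_mod_cast hMN.2
      nlinarith
    calc _ ≤ (Set.ncard {r : Fin N | ∃ p ∈ S, |((r : ℕ) : ℝ) / N - p| ≤ η} : ℝ) := by
          exact_mod_cast Set.ncard_le_ncard hsub (Set.toFinite _)
      _ ≤ S.card * (2 * η * N + 1) := ncard_grid_near_le S hη hN.pos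
      _ ≤ ε * N := by nlinarith

/-- **NRG on a subsequence.** If `Û : ℝ → M_ν(ℂ)` has analytic entries, is normal at
every point, is `1`-periodic, and admits an analytic eigenvalue selection with no flat
band, then the No Repeating Graphs condition holds along some strictly increasing
sequence `(N_n)` of positive integers. -/
theorem NRG_on_subsequence
    {ν : ℕ} (hν : 1 ≤ ν)
    (U : ℝ → Matrix (Fin ν) (Fin ν) ℂ)
    (hUanalytic : ∀ (i j : Fin ν) (x : ℝ), AnalyticAt ℝ (fun θ => U θ i j) x)
    (hUnormal : ∀ θ : ℝ, IsStarNormal (U θ))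
    (hUperiodic : ∀ θ : ℝ, U (θ + 1) = U θ)
    (E : Fin ν → ℝ → ℂ)
    (hEanalytic : ∀ (i : Fin ν) (x : ℝ), AnalyticAt ℝ (E i) x)
    (hEroots : ∀ θ : ℝ,
      (U θ).charpoly = ∏ i : Fin ν, (Polynomial.X - Polynomial.C (E i θ)))
    (hNoFlat : ∀ i : Fin ν, ¬ ∃ z : ℂ, ∀ θ : ℝ, E i θ = z) :
    ∃ Ns : ℕ → ℕ, StrictMono Ns ∧ (∀ n, 0 < Ns n) ∧
      ∀ s w : Fin ν,
        Tendsto (fun n : ℕ =>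
          ((((Finset.Ioo 0 (Ns n)).sup fun m =>
            Set.ncard {r : Fin (Ns n) |
              E s ((((r : ℕ) + m : ℕ) : ℝ) / ((Ns n : ℕ) : ℝ))
                = E w (((r : ℕ) : ℝ) / ((Ns n : ℕ) : ℝ))}) : ℕ) : ℝ) / ((Ns n : ℕ) : ℝ))
          atTop (nhds 0) := by
  refine ⟨Nat.nth Nat.Prime, Nat.nth_strictMono Nat.infinite_setOfPred_prime,
    fun n => (Nat.prime_nth_prime n).pos, fun s w => ?_⟩
  rw [Metric.tendsto_atTop]
  intro ε hε
  obtain ⟨M, hM⟩ := exists_forall_prime_ncard_le (hEanalytic s) (hEanalytic w) (hNoFlat w)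
    (half_pos hε)
  refine ⟨M + 1, fun n hn => ?_⟩
  have hprime := Nat.prime_nth_prime n
  have hMn : M < Nat.nth Nat.Prime n :=
    hn.trans (Nat.nth_strictMono Nat.infinite_setOfPred_prime).le_apply
  have hpos : (0 : ℝ) < Nat.nth Nat.Prime n := by exact_mod_cast hprime.pos
  rw [Real.dist_eq, sub_zero, abs_of_nonneg (by positivity), div_lt_iff₀ hpos]
  have hnn : 0 ≤ ε / 2 * Nat.nth Nat.Prime n := by positivity
  refine lt_of_le_of_lt ((Nat.le_floor_iff hnn).1 (Finset.sup_le fun m hm => ?_))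
    (by nlinarith : ε / 2 * Nat.nth Nat.Prime n < ε * Nat.nth Nat.Prime n)
  rw [Finset.mem_Ioo] at hm
  exact Nat.le_floor (hM _ hprime hMn m hm.1 hm.2)
end
end

section
/- Let ν ≥ 1, let Û : ℝ → M_ν(ℂ) have analytic entries with Û(θ) normal for every θ, and let E_1,…,E_ν be an analytic eigenvalue selection for Û. Fix s, w ∈ {1,…,ν} and for N ≥ 2 set C(N) = max over m ∈ {1,…,N−1} of #{r ∈ {0,…,N−1} : E_s((r+m)/N) = E_w(r/N)}. Then the following are equivalent: (i) C(N)/N does not tend to 0 as N → ∞; (ii) limsup_{N→∞} C(N) = ∞, i.e. C is unbounded; (iii) there exists a rational number φ with 0 < φ < 1 such that E_s(θ + φ) = E_w(θ) for all θ ∈ ℝ. Moreover, if there exist a strictly increasing sequence (N_k) and m_k ∈ {1,…,N_k − 1} with m_k/N_k → 0 and such that #{r ∈ {0,…,N_k − 1} : E_s((r+m_k)/N_k) = E_w(r/N_k)}/N_k does not tend to 0, then E_s and E_w are both constant functions, equal to one another. -/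
open Filter

noncomputable section

section ZeroCounting

open Set Topology

/-- Between the points of a finite set of zeros there are zeros of the derivative. -/
lemma exists_finset_deriv_zeros {u : ℝ → ℝ} (hu : Continuous u) {I : Set ℝ} (hI : I.OrdConnected)
    (S : Finset ℝ) (hSI : (S : Set ℝ) ⊆ I) (hS : ∀ x ∈ S, u x = 0) :
    ∃ T : Finset ℝ, (T : Set ℝ) ⊆ I ∧ (∀ x ∈ T, deriv u x = 0) ∧ S.card ≤ T.card + 1 := by
  obtain hcard | ⟨n, hn⟩ : S.card = 0 ∨ ∃ n, S.card = n + 1 := by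
    cases h : S.card with
    | zero => exact Or.inl rfl
    | succ n => exact Or.inr ⟨n, rfl⟩
  · exact ⟨∅, by simp, by simp, by omega⟩
  let x := S.orderEmbOfFin hn
  have hxS : ∀ i, x i ∈ S := S.orderEmbOfFin_mem hn
  have hlt : ∀ i : Fin n, x i.castSucc < x i.succ := fun i =>
    x.strictMono i.castSucc_lt_succ
  have hex : ∀ i : Fin n, ∃ c ∈ Ioo (x i.castSucc) (x i.succ), deriv u c = 0 := fun i =>
    exists_deriv_eq_zero (hlt i) hu.continuousOn (by rw [hS _ (hxS _), hS _ (hxS _)])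
  choose c hc hc0 using hex
  have hmono : StrictMono c := by
    intro i j hij
    have : x i.succ ≤ x j.castSucc := x.monotone (by
      rw [Fin.le_def]; simpa [Fin.val_succ] using hij)
    exact (hc i).2.trans_le (this.trans (hc j).1.le)
  refine ⟨Finset.univ.map ⟨c, hmono.injective⟩, ?_, ?_, by simp [hn]⟩
  · intro y hy
    obtain ⟨i, rfl⟩ : ∃ i, c i = y := by simpa using hy
    exact hI.out (hSI (hxS _)) (hSI (hxS _)) (Ioo_subset_Icc_self (hc i))
  · intro y hy
    obtain ⟨i, rfl⟩ : ∃ i, c i = y := by simpa using hy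
    exact hc0 i

/-- A smooth function whose `k`-th derivative does not vanish on an interval has at most `k`
zeros there. -/
lemma card_zeros_le_of_iteratedDeriv_ne_zero {I : Set ℝ} (hI : I.OrdConnected) (k : ℕ) :
    ∀ {u : ℝ → ℝ}, (∀ n, Continuous (iteratedDeriv n u)) →
      (∀ x ∈ I, iteratedDeriv k u x ≠ 0) →
      ∀ S : Finset ℝ, (S : Set ℝ) ⊆ I → (∀ x ∈ S, u x = 0) → S.card ≤ k := by
  induction k with
  | zero =>
    intro u _ hne S hSI hS
    rw [Nat.le_zero, Finset.card_eq_zero, Finset.eq_empty_iff_forall_notMem]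
    intro x hx
    exact hne x (hSI hx) (by simpa using hS x hx)
  | succ k ih =>
    intro u hu hne S hSI hS
    obtain ⟨T, hTI, hT, hcard⟩ :=
      exists_finset_deriv_zeros (by simpa using hu 0) hI S hSI hS
    have := ih (u := deriv u) (fun n => by rw [← iteratedDeriv_succ']; exact hu (n + 1))
      (fun x hx => by rw [← iteratedDeriv_succ']; exact hne x hx) T hTI hT
    omega

/-- If locally some derivative of `H φ` does not vanish, uniformly in `φ` along a filter, then
the number of zeros of `H φ` on a compact set is bounded along that filter. -/
lemma exists_eventually_card_zeros_le {Φ : Type*} {l : Filter Φ} {H : Φ → ℝ → ℝ}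
    (hH : ∀ φ n, Continuous (iteratedDeriv n (H φ))) {K : Set ℝ} (hK : IsCompact K)
    (hloc : ∀ x ∈ K, ∃ k, ∀ᶠ p in l ×ˢ 𝓝 x, iteratedDeriv k (H p.1) p.2 ≠ 0) :
    ∃ B : ℕ, ∀ᶠ φ in l, ∀ S : Finset ℝ, (S : Set ℝ) ⊆ K → (∀ x ∈ S, H φ x = 0) →
      S.card ≤ B := by
  refine hK.induction_on (p := fun A => ∃ B : ℕ, ∀ᶠ φ in l, ∀ S : Finset ℝ, (S : Set ℝ) ⊆ A →
    (∀ x ∈ S, H φ x = 0) → S.card ≤ B) ?_ ?_ ?_ ?_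
  · refine ⟨0, Eventually.of_forall fun φ S hS _ => ?_⟩
    simpa [Set.subset_empty_iff] using hS
  · rintro A A' hAA' ⟨B, hB⟩
    exact ⟨B, hB.mono fun φ h S hS => h S (hS.trans hAA')⟩
  · rintro A A' ⟨B, hB⟩ ⟨B', hB'⟩
    refine ⟨B + B', ?_⟩
    filter_upwards [hB, hB'] with φ h h' S hS h0
    classical
    rw [← Finset.card_filter_add_card_filter_not (s := S) (· ∈ A)]
    refine add_le_add (h _ ?_ ?_) (h' _ ?_ ?_)
    · intro x hx
      simp only [Finset.coe_filter, mem_ofPred_eq] at hx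
      exact hx.2
    · exact fun x hx => h0 x (Finset.mem_filter.1 hx).1
    · intro x hx
      simp only [Finset.coe_filter, mem_ofPred_eq] at hx
      exact (hS hx.1).resolve_left hx.2
    · exact fun x hx => h0 x (Finset.mem_filter.1 hx).1
  · intro x hx
    obtain ⟨k, hk⟩ := hloc x hx
    obtain ⟨P, hP, Q, hQ, hPQ⟩ := eventually_prod_iff.1 hk
    obtain ⟨ε, hε, hball⟩ := Metric.mem_nhds_iff.1 hQ
    refine ⟨Metric.ball x ε, mem_nhdsWithin_of_mem_nhds (Metric.ball_mem_nhds x hε), k, ?_⟩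
    filter_upwards [hP] with φ hφ S hS h0
    exact card_zeros_le_of_iteratedDeriv_ne_zero (Real.ball_eq_Ioo x ε ▸ ordConnected_Ioo) k
      (hH φ) (fun y hy => hPQ hφ (hball hy)) S hS h0

/-- A real analytic function that is not identically zero has a nonzero derivative of some order
at every point. -/
lemma exists_iteratedDeriv_ne_zero {u : ℝ → ℝ} (hu : ∀ x, AnalyticAt ℝ u x)
    (hne : ∃ x, u x ≠ 0) (x : ℝ) : ∃ k, iteratedDeriv k u x ≠ 0 := by
  by_contra! h
  obtain ⟨y, hy⟩ := hne
  have htop : analyticOrderAt u x = ⊤ := by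
    refine ENat.eq_top_iff_forall_ge.2 fun n => ?_
    exact (natCast_le_analyticOrderAt_iff_iteratedDeriv_eq_zero (hu x)).2 fun i _ => h i
  have hev := analyticOrderAt_eq_top.1 htop
  exact hy (congrFun (AnalyticOnNhd.eq_of_eventuallyEq (g := 0) (z₀ := x)
    (fun z _ => hu z) (fun z _ => analyticAt_const) hev) y)

lemma continuous_iteratedDeriv_of_analyticAt {u : ℝ → ℝ} (hu : ∀ x, AnalyticAt ℝ u x) (n : ℕ) :
    Continuous (iteratedDeriv n u) :=
  (contDiff_iff_contDiffAt.2 fun x => (hu x).contDiffAt (n := n)).continuous_iteratedDeriv n le_rfl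

lemma analyticAt_comp_add_const {u : ℝ → ℝ} (hu : ∀ x, AnalyticAt ℝ u x) (φ x : ℝ) :
    AnalyticAt ℝ (fun θ => u (θ + φ)) x :=
  AnalyticAt.fun_comp (g := u) (f := fun θ => θ + φ) (hu (x + φ)) (by fun_prop)

lemma iteratedDeriv_translate_sub {u v : ℝ → ℝ} (hu : ∀ x, AnalyticAt ℝ u x)
    (hv : ∀ x, AnalyticAt ℝ v x) (φ : ℝ) (n : ℕ) (x : ℝ) :
    iteratedDeriv n (fun θ => u (θ + φ) - v θ) x =
      iteratedDeriv n u (x + φ) - iteratedDeriv n v x := by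
  rw [iteratedDeriv_fun_sub (analyticAt_comp_add_const hu φ x).contDiffAt (hv x).contDiffAt,
    iteratedDeriv_comp_add_const]

/-- If `u (· + φ₀)` is not `v`, the number of `θ ∈ [0, 1]` with `u (θ + φ) = v θ` is bounded for
`φ` near `φ₀`. -/
lemma eventually_card_coincidences_le_of_ne {u v : ℝ → ℝ} (hu : ∀ x, AnalyticAt ℝ u x)
    (hv : ∀ x, AnalyticAt ℝ v x) {φ₀ : ℝ} (hne : ∃ θ, u (θ + φ₀) ≠ v θ) :
    ∃ B : ℕ, ∀ᶠ φ in 𝓝 φ₀, ∀ S : Finset ℝ, (S : Set ℝ) ⊆ Icc 0 1 →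
      (∀ x ∈ S, u (x + φ) = v x) → S.card ≤ B := by
  have hcu := continuous_iteratedDeriv_of_analyticAt hu
  have hcv := continuous_iteratedDeriv_of_analyticAt hv
  have key := exists_eventually_card_zeros_le (l := 𝓝 φ₀) (H := fun φ θ => u (θ + φ) - v θ)
    (fun φ n => by
      rw [funext (iteratedDeriv_translate_sub hu hv φ n)]
      exact ((hcu n).comp (by fun_prop)).sub (hcv n)) (isCompact_Icc (a := (0 : ℝ)) (b := 1)) ?_
  · simpa only [sub_eq_zero] using key
  intro x _
  have hw : ∀ y, AnalyticAt ℝ (fun θ => u (θ + φ₀) - v θ) y := fun y =>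
    (analyticAt_comp_add_const hu φ₀ y).sub (hv y)
  obtain ⟨k, hk⟩ := exists_iteratedDeriv_ne_zero hw (by simpa only [sub_ne_zero] using hne) x
  refine ⟨k, ?_⟩
  simp only [iteratedDeriv_translate_sub hu hv] at hk ⊢
  rw [← nhds_prod_eq]
  have hcont : Continuous fun p : ℝ × ℝ => iteratedDeriv k u (p.2 + p.1) - iteratedDeriv k v p.2 :=
    ((hcu k).comp (by fun_prop)).sub ((hcv k).comp continuous_snd)
  exact hcont.continuousAt.eventually_ne hk

/-- If `u` is not constant, the number of `θ ∈ [0, 1]` with `u (θ + φ) = u (θ + φ₀)` is bounded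
for `φ ≠ φ₀` near `φ₀`. -/
lemma eventually_card_coincidences_le_of_eq {u : ℝ → ℝ} (hu : ∀ x, AnalyticAt ℝ u x)
    (hne : ∃ a b, u a ≠ u b) (φ₀ : ℝ) :
    ∃ B : ℕ, ∀ᶠ φ in 𝓝[≠] φ₀, ∀ S : Finset ℝ, (S : Set ℝ) ⊆ Icc 0 1 →
      (∀ x ∈ S, u (x + φ) = u (x + φ₀)) → S.card ≤ B := by
  have hcu := continuous_iteratedDeriv_of_analyticAt hu
  have hv : ∀ x, AnalyticAt ℝ (fun θ => u (θ + φ₀)) x := fun x =>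
    analyticAt_comp_add_const hu φ₀ x
  have hder := fun φ => iteratedDeriv_translate_sub hu hv φ
  have key := exists_eventually_card_zeros_le (l := 𝓝[≠] φ₀)
    (H := fun φ θ => u (θ + φ) - u (θ + φ₀))
    (fun φ n => by
      rw [funext (hder φ n)]
      exact ((hcu n).comp (by fun_prop)).sub (continuous_iteratedDeriv_of_analyticAt hv n))
    (isCompact_Icc (a := (0 : ℝ)) (b := 1)) ?_
  · simpa only [sub_eq_zero] using key
  intro x _
  have hd : ∃ y, deriv u y ≠ 0 := by
    by_contra! h
    obtain ⟨a, b, hab⟩ := hne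
    exact hab (is_const_of_deriv_eq_zero (fun y => (hu y).differentiableAt) h a b)
  obtain ⟨k, hk⟩ := exists_iteratedDeriv_ne_zero (fun y => (hu y).deriv) hd (x + φ₀)
  rw [← iteratedDeriv_succ'] at hk
  obtain ⟨ε, hε, hball⟩ :=
    Metric.mem_nhds_iff.1 ((hcu (k + 1)).continuousAt.eventually_ne hk)
  have hlt : ∀ a ∈ Metric.ball (x + φ₀) ε, ∀ b ∈ Metric.ball (x + φ₀) ε, a < b →
      iteratedDeriv k u a ≠ iteratedDeriv k u b := by
    intro a ha b hb hab heq
    obtain ⟨c, hc, hc0⟩ := exists_deriv_eq_zero hab (hcu k).continuousOn heq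
    rw [← iteratedDeriv_succ] at hc0
    rw [Real.ball_eq_Ioo] at ha hb hball
    exact hball ⟨ha.1.trans hc.1, hc.2.trans hb.2⟩ hc0
  refine ⟨k, ?_⟩
  simp only [hder, iteratedDeriv_comp_add_const]
  have hle : 𝓝[≠] φ₀ ×ˢ 𝓝 x ≤ 𝓝 (φ₀, x) := by
    rw [nhds_prod_eq]
    exact Filter.prod_mono nhdsWithin_le_nhds le_rfl
  have h₁ : ∀ᶠ p : ℝ × ℝ in 𝓝[≠] φ₀ ×ˢ 𝓝 x, p.2 + p.1 ∈ Metric.ball (x + φ₀) ε :=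
    hle ((Continuous.tendsto (by fun_prop : Continuous fun p : ℝ × ℝ => p.2 + p.1) (φ₀, x))
      (Metric.ball_mem_nhds _ hε))
  have h₂ : ∀ᶠ p : ℝ × ℝ in 𝓝[≠] φ₀ ×ˢ 𝓝 x, p.2 + φ₀ ∈ Metric.ball (x + φ₀) ε :=
    hle ((Continuous.tendsto (by fun_prop : Continuous fun p : ℝ × ℝ => p.2 + φ₀) (φ₀, x))
      (Metric.ball_mem_nhds _ hε))
  have h₃ : ∀ᶠ p : ℝ × ℝ in 𝓝[≠] φ₀ ×ˢ 𝓝 x, p.1 ≠ φ₀ :=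
    tendsto_fst.eventually self_mem_nhdsWithin
  filter_upwards [h₁, h₂, h₃] with p hp₁ hp₂ hp₃
  rw [sub_ne_zero]
  rcases lt_or_gt_of_ne hp₃ with h | h
  · exact hlt _ hp₁ _ hp₂ (by linarith)
  · exact (hlt _ hp₂ _ hp₁ (by linarith)).symm

/-- Unless `f` and `g` are the same constant, the number of `θ ∈ [0, 1]` with
`f (θ + φ) = g θ` is bounded for `φ` near `φ₀`, with the exception of `φ = φ₀` if `f (· + φ₀)`
is `g`. -/
lemma eventually_card_coincidences_le {f g : ℝ → ℂ} (hf : ∀ x, AnalyticAt ℝ f x)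
    (hg : ∀ x, AnalyticAt ℝ g x) (hfg : ¬ ((∀ a b, f a = f b) ∧ ∀ θ, f θ = g θ)) (φ₀ : ℝ) :
    ∃ B : ℕ, ∀ᶠ φ in 𝓝 φ₀, (φ = φ₀ → ∃ θ, f (θ + φ₀) ≠ g θ) →
      ∀ S : Finset ℝ, (S : Set ℝ) ⊆ Icc 0 1 → (∀ x ∈ S, f (x + φ) = g x) → S.card ≤ B := by
  have hcomp : ∀ (L : ℂ →L[ℝ] ℝ) {h : ℝ → ℂ}, (∀ x, AnalyticAt ℝ h x) →
      ∀ x, AnalyticAt ℝ (fun y => L (h y)) x := fun L h hh x =>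
    (L.analyticAt (h x)).comp (hh x)
  have hsep : ∀ a b : ℂ, a ≠ b → ∃ L : ℂ →L[ℝ] ℝ, L a ≠ L b := by
    intro a b hab
    by_contra! h
    exact hab (Complex.ext (h Complex.reCLM) (h Complex.imCLM))
  by_cases hφ₀ : ∃ θ, f (θ + φ₀) ≠ g θ
  · obtain ⟨θ, hθ⟩ := hφ₀
    obtain ⟨L, hL⟩ := hsep _ _ hθ
    obtain ⟨B, hB⟩ :=
      eventually_card_coincidences_le_of_ne (hcomp L hf) (hcomp L hg) ⟨θ, hL⟩
    exact ⟨B, hB.mono fun φ h _ S hS hx => h S hS fun x hxS => congrArg L (hx x hxS)⟩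
  · push Not at hφ₀
    obtain ⟨a, b, hab⟩ : ∃ a b, f a ≠ f b := by
      by_contra! h
      exact hfg ⟨h, fun θ => (h _ _).trans (hφ₀ θ)⟩
    obtain ⟨L, hL⟩ := hsep _ _ hab
    obtain ⟨B, hB⟩ := eventually_card_coincidences_le_of_eq (hcomp L hf) ⟨a, b, hL⟩ φ₀
    refine ⟨B, (eventually_nhdsWithin_iff.1 hB).mono fun φ h hφ S hS hx => ?_⟩
    refine h (fun he => ?_) S hS fun x hxS => congrArg L ((hx x hxS).trans (hφ₀ x).symm)
    obtain ⟨θ, hθ⟩ := hφ he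
    exact hθ (hφ₀ θ)

/-- A bound for the coincidences in `[0, 1]` bounds the coincidences on the grid. -/
lemma ncard_grid_coincidences_le {f g : ℝ → ℂ} {N m B : ℕ}
    (h : ∀ S : Finset ℝ, (S : Set ℝ) ⊆ Icc 0 1 →
      (∀ x ∈ S, f (x + (m : ℝ) / N) = g x) → S.card ≤ B) :
    Set.ncard {r : Fin N | f ((((r : ℕ) + m : ℕ) : ℝ) / (N : ℝ)) =
      g (((r : ℕ) : ℝ) / (N : ℝ))} ≤ B := by
  classical
  have hinj : Function.Injective fun r : Fin N => ((r : ℕ) : ℝ) / (N : ℝ) := by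
    intro a b hab
    have hN : (N : ℝ) ≠ 0 := by
      have := a.pos
      positivity
    exact Fin.ext (by exact_mod_cast (div_left_inj' hN).1 hab)
  rw [Set.ncard_eq_toFinset_card', ← Finset.card_map ⟨_, hinj⟩]
  refine h _ ?_ ?_
  · intro y hy
    obtain ⟨r, -, rfl⟩ := Finset.mem_map.1 (Finset.mem_coe.1 hy)
    refine ⟨by simp only [Function.Embedding.coeFn_mk]; positivity, ?_⟩
    exact div_le_one_of_le₀ (by exact_mod_cast r.2.le) (by positivity)
  · intro y hy
    obtain ⟨r, hr, rfl⟩ := Finset.mem_map.1 hy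
    simpa [add_div] using hr

/-- The grid coincidence numbers are uniformly bounded if no rational shift in `(0, 1)`
carries `f` to `g`. -/
lemma exists_ncard_grid_coincidences_le {f g : ℝ → ℂ} (hf : ∀ x, AnalyticAt ℝ f x)
    (hg : ∀ x, AnalyticAt ℝ g x)
    (hfg : ¬ ∃ φ : ℚ, 0 < φ ∧ φ < 1 ∧ ∀ θ : ℝ, f (θ + (φ : ℝ)) = g θ) :
    ∃ B : ℕ, ∀ N m : ℕ, 0 < m → m < N →
      Set.ncard {r : Fin N | f ((((r : ℕ) + m : ℕ) : ℝ) / (N : ℝ)) =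
        g (((r : ℕ) : ℝ) / (N : ℝ))} ≤ B := by
  push Not at hfg
  have hnc : ¬ ((∀ a b, f a = f b) ∧ ∀ θ, f θ = g θ) := by
    rintro ⟨hc, he⟩
    obtain ⟨θ, hθ⟩ := hfg (1 / 2) (by norm_num) (by norm_num)
    exact hθ ((hc _ _).trans (he θ))
  obtain ⟨B, hB⟩ : ∃ B : ℕ, ∀ φ ∈ Icc (0 : ℝ) 1, (∃ q : ℚ, 0 < q ∧ q < 1 ∧ (q : ℝ) = φ) →
      ∀ S : Finset ℝ, (S : Set ℝ) ⊆ Icc 0 1 → (∀ x ∈ S, f (x + φ) = g x) → S.card ≤ B := by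
    refine (isCompact_Icc (a := (0 : ℝ)) (b := 1)).induction_on (p := fun A => ∃ B : ℕ, ∀ φ ∈ A,
      (∃ q : ℚ, 0 < q ∧ q < 1 ∧ (q : ℝ) = φ) →
      ∀ S : Finset ℝ, (S : Set ℝ) ⊆ Icc 0 1 → (∀ x ∈ S, f (x + φ) = g x) → S.card ≤ B)
      ⟨0, by simp⟩ ?_ ?_ ?_
    · rintro A A' hAA' ⟨B, hB⟩
      exact ⟨B, fun φ hφ => hB φ (hAA' hφ)⟩
    · rintro A A' ⟨B, hB⟩ ⟨B', hB'⟩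
      refine ⟨max B B', fun φ hφ hq S hS hx => ?_⟩
      rcases hφ with hφ | hφ
      · exact (hB φ hφ hq S hS hx).trans (le_max_left _ _)
      · exact (hB' φ hφ hq S hS hx).trans (le_max_right _ _)
    · intro φ₀ _
      obtain ⟨B, hB⟩ := eventually_card_coincidences_le hf hg hnc φ₀
      refine ⟨_, mem_nhdsWithin_of_mem_nhds hB, B, fun φ hφ ⟨q, hq0, hq1, hq⟩ => hφ ?_⟩
      rintro rfl
      rw [← hq]
      exact hfg q hq0 hq1
  refine ⟨B, fun N m hm hmN => ncard_grid_coincidences_le (hB _ ?_ ⟨(m : ℚ) / N, ?_, ?_, ?_⟩)⟩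
  · exact ⟨by positivity, div_le_one_of_le₀ (by exact_mod_cast hmN.le) (by positivity)⟩
  · have : 0 < N := hm.trans hmN
    positivity
  · rw [div_lt_one (by exact_mod_cast hm.trans hmN)]
    exact_mod_cast hmN
  · push_cast
    rfl

/-- If `f (· + m / N) = g`, then every point of the grid with `N` points is a coincidence for
the shift by `m` steps. -/
lemma ncard_grid_coincidences_eq {f g : ℝ → ℂ} {φ : ℝ} (h : ∀ θ, f (θ + φ) = g θ) {N m : ℕ}
    (hφ : (m : ℝ) / N = φ) :
    Set.ncard {r : Fin N | f ((((r : ℕ) + m : ℕ) : ℝ) / (N : ℝ)) =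
      g (((r : ℕ) : ℝ) / (N : ℝ))} = N := by
  have : {r : Fin N | f ((((r : ℕ) + m : ℕ) : ℝ) / (N : ℝ)) =
      g (((r : ℕ) : ℝ) / (N : ℝ))} = Set.univ := by
    refine Set.eq_univ_of_forall fun r => ?_
    simp only [Set.mem_ofPred_eq, Nat.cast_add, add_div, hφ, h]
  rw [this, Set.ncard_univ, Nat.card_fin]

lemma tendsto_natCast_div_zero_of_le {a b : ℕ → ℕ} {B : ℕ} (hb : Tendsto b atTop atTop)
    (hab : ∀ᶠ k in atTop, a k ≤ B) :
    Tendsto (fun k => (a k : ℝ) / (b k : ℝ)) atTop (𝓝 0) := by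
  have hlim : Tendsto (fun k => (B : ℝ) / (b k : ℝ)) atTop (𝓝 0) :=
    tendsto_const_nhds.div_atTop (tendsto_natCast_atTop_atTop.comp hb)
  refine tendsto_of_tendsto_of_tendsto_of_le_of_le' tendsto_const_nhds hlim
    (Eventually.of_forall fun k => by positivity) ?_
  filter_upwards [hab] with k hk
  gcongr

end ZeroCounting

/-- **Phase-shift characterization of NRG failure in dimension one.** For an analytic
eigenvalue selection `E_1,…,E_ν` of an analytic family of normal matrices, set
`C(N) = max_{1 ≤ m < N} #{r < N : E_s((r+m)/N) = E_w(r/N)}`. Then `C(N)/N ↛ 0` iff `C`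
is unbounded, iff there is a rational `0 < φ < 1` with `E_s(·+φ) ≡ E_w`. Moreover, if
the fraction fails to tend to `0` along a subsequence with `m_k/N_k → 0`, then `E_s`
and `E_w` are flat bands, equal to one another. -/
theorem one_dim_NRG_failure_characterization
    {ν : ℕ} (hν : 1 ≤ ν)
    (U : ℝ → Matrix (Fin ν) (Fin ν) ℂ)
    (hUanalytic : ∀ (i j : Fin ν) (x : ℝ), AnalyticAt ℝ (fun θ => U θ i j) x)
    (hUnormal : ∀ θ : ℝ, IsStarNormal (U θ))
    (E : Fin ν → ℝ → ℂ)
    (hEanalytic : ∀ (i : Fin ν) (x : ℝ), AnalyticAt ℝ (E i) x)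
    (hEroots : ∀ θ : ℝ,
      (U θ).charpoly = ∏ i : Fin ν, (Polynomial.X - Polynomial.C (E i θ)))
    (s w : Fin ν)
    (C : ℕ → ℕ)
    (hC : ∀ N : ℕ, C N = (Finset.Ioo 0 N).sup fun m =>
      Set.ncard {r : Fin N |
        E s ((((r : ℕ) + m : ℕ) : ℝ) / (N : ℝ)) = E w (((r : ℕ) : ℝ) / (N : ℝ))}) :
    ((¬ Tendsto (fun N : ℕ => ((C N : ℕ) : ℝ) / (N : ℝ)) atTop (nhds 0)) ↔
        (∀ B : ℕ, ∃ N : ℕ, B ≤ C N))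
    ∧ ((∀ B : ℕ, ∃ N : ℕ, B ≤ C N) ↔
        (∃ φ : ℚ, 0 < φ ∧ φ < 1 ∧ ∀ θ : ℝ, E s (θ + (φ : ℝ)) = E w θ))
    ∧ (∀ (Nk : ℕ → ℕ) (mk : ℕ → ℕ), StrictMono Nk →
        (∀ k, 1 ≤ mk k ∧ mk k < Nk k) →
        Tendsto (fun k => ((mk k : ℕ) : ℝ) / ((Nk k : ℕ) : ℝ)) atTop (nhds 0) →
        ¬ Tendsto (fun k =>
            ((Set.ncard {r : Fin (Nk k) |
              E s ((((r : ℕ) + mk k : ℕ) : ℝ) / ((Nk k : ℕ) : ℝ))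
                = E w (((r : ℕ) : ℝ) / ((Nk k : ℕ) : ℝ))} : ℕ) : ℝ) / ((Nk k : ℕ) : ℝ))
            atTop (nhds 0) →
        (∀ θ₁ θ₂ : ℝ, E s θ₁ = E s θ₂) ∧ (∀ θ : ℝ, E s θ = E w θ)) := by
  have hf := hEanalytic s
  have hg := hEanalytic w
  have unbounded_of_not_tendsto :
      (¬ Tendsto (fun N : ℕ => ((C N : ℕ) : ℝ) / (N : ℝ)) atTop (nhds 0)) →
        ∀ B : ℕ, ∃ N : ℕ, B ≤ C N := by
    contrapose!
    rintro ⟨B, hB⟩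
    exact tendsto_natCast_div_zero_of_le tendsto_id (Eventually.of_forall fun N => (hB N).le)
  have shift_of_unbounded : (∀ B : ℕ, ∃ N : ℕ, B ≤ C N) →
      ∃ φ : ℚ, 0 < φ ∧ φ < 1 ∧ ∀ θ : ℝ, E s (θ + (φ : ℝ)) = E w θ := by
    intro hunb
    by_contra hno
    obtain ⟨B, hB⟩ := exists_ncard_grid_coincidences_le hf hg hno
    obtain ⟨N, hN⟩ := hunb (B + 1)
    have : C N ≤ B := by
      rw [hC]
      refine Finset.sup_le fun m hm => ?_
      rw [Finset.mem_Ioo] at hm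
      exact hB N m hm.1 hm.2
    omega
  have not_tendsto_of_shift :
      (∃ φ : ℚ, 0 < φ ∧ φ < 1 ∧ ∀ θ : ℝ, E s (θ + (φ : ℝ)) = E w θ) →
        ¬ Tendsto (fun N : ℕ => ((C N : ℕ) : ℝ) / (N : ℝ)) atTop (nhds 0) := by
    rintro ⟨φ, hφ0, hφ1, hφ⟩ htend
    obtain ⟨p, hp⟩ := Int.eq_ofNat_of_zero_le (Rat.num_pos.2 hφ0).le
    have hp0 : 0 < p := by
      have := Rat.num_pos.2 hφ0
      omega
    have hpq : p < φ.den := by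
      have := Rat.num_lt_denom_iff.2 hφ1
      omega
    have hφpq : (φ : ℝ) = (p : ℝ) / φ.den := by
      rw [Rat.cast_def, hp]
      simp
    have hC_ge : ∀ k : ℕ, (k + 1) * φ.den ≤ C ((k + 1) * φ.den) := by
      intro k
      have hcount := ncard_grid_coincidences_eq hφ (N := (k + 1) * φ.den) (m := (k + 1) * p) (by
        rw [hφpq]
        push_cast
        exact mul_div_mul_left _ _ (by positivity))
      rw [hC]
      calc (k + 1) * φ.den = _ := hcount.symm
        _ ≤ _ := Finset.le_sup (f := fun m => Set.ncard {r : Fin ((k + 1) * φ.den) |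
            E s ((((r : ℕ) + m : ℕ) : ℝ) / (((k + 1) * φ.den : ℕ) : ℝ)) =
              E w (((r : ℕ) : ℝ) / (((k + 1) * φ.den : ℕ) : ℝ))})
            (Finset.mem_Ioo.2 ⟨by positivity, by gcongr⟩)
    have hsub : Tendsto (fun k : ℕ => (k + 1) * φ.den) atTop atTop :=
      tendsto_atTop_mono (fun k => (Nat.le_succ k).trans (Nat.le_mul_of_pos_right _ φ.pos))
        tendsto_id
    have hge := ge_of_tendsto' (htend.comp hsub) (b := 1) fun k => by
      have hpos : (0 : ℝ) < (((k + 1) * φ.den : ℕ) : ℝ) := by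
        exact_mod_cast Nat.mul_pos k.succ_pos φ.pos
      simp only [Function.comp_apply]
      rw [one_le_div hpos]
      exact_mod_cast hC_ge k
    norm_num at hge
  refine ⟨⟨unbounded_of_not_tendsto, fun h => not_tendsto_of_shift (shift_of_unbounded h)⟩,
    ⟨shift_of_unbounded, fun h => unbounded_of_not_tendsto (not_tendsto_of_shift h)⟩, ?_⟩
  intro Nk mk hNk hmk hlim
  contrapose!
  intro hnc
  obtain ⟨B, hB⟩ := eventually_card_coincidences_le hf hg
    (fun h => (hnc h.1).elim fun θ hθ => hθ (h.2 θ)) 0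
  refine tendsto_natCast_div_zero_of_le (B := B) hNk.tendsto_atTop ?_
  filter_upwards [hlim.eventually hB] with k hk
  refine ncard_grid_coincidences_le (hk fun h0 => ?_)
  have hm : 0 < mk k := (hmk k).1
  have hN : 0 < Nk k := hm.trans (hmk k).2
  have : (0 : ℝ) < (mk k : ℝ) / Nk k := by positivity
  exact absurd h0 this.ne'
end
end

section
/- Let α, β ≥ 1 be integers with gcd(α,β) = 1, and let a,b,c,d ∈ ℂ be such that the 2×2 matrix [[a,b],[c,d]] is unitary and a·b·c·d ≠ 0. Define the Floquet matrix Û(θ) = [[a·exp(2πi α θ), b·exp(2πi α θ)],[c·exp(−2πi β θ), d·exp(−2πi β θ)]] for θ ∈ ℝ. Then the spectral NRG condition holds: max over m ∈ {1,…,N−1} of N^{−1}·#{r ∈ {0,…,N−1} : spectrum(Û((r+m)/N)) ∩ spectrum(Û(r/N)) ≠ ∅} tends to 0 as N → ∞. -/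
open Filter

noncomputable section

namespace QW1

/-- Spectral "No Repeating Graphs" condition in dimension one. -/
def SpectralNRG {ι : Type*} [Fintype ι] [DecidableEq ι] (U : ℝ → Matrix ι ι ℂ) : Prop :=
  ∀ ε : ℝ, 0 < ε → ∃ N₀ : ℕ, ∀ N : ℕ, N₀ ≤ N → ∀ m : ℕ, 1 ≤ m → m < N →
    ((Set.ncard {r : Fin N |
      (spectrum ℂ (U ((((r : ℕ) + m : ℕ) : ℝ) / (N : ℝ))) ∩
       spectrum ℂ (U (((r : ℕ) : ℝ) / (N : ℝ)))).Nonempty}) : ℝ) / (N : ℝ) < ε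

/-- A spectral value of a `2 × 2` complex matrix is a root of its characteristic polynomial. -/
theorem charpoly_eq_zero_of_mem_spectrum {p q r s l : ℂ}
    (h : l ∈ spectrum ℂ (!![p, q; r, s] : Matrix (Fin 2) (Fin 2) ℂ)) :
    l ^ 2 - (p + s) * l + (p * s - q * r) = 0 := by
  rw [spectrum.mem_iff, Matrix.isUnit_iff_isUnit_det, isUnit_iff_ne_zero, not_not,
    Matrix.det_fin_two] at h
  simp [Matrix.algebraMap_matrix_apply] at h
  linear_combination h

/-- The trinomial in `z` whose vanishing is forced by a common eigenvalue of the Floquet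
matrices at quasi-momenta `z` and `z * w`, where `X = w ^ α` and `Y = w ^ (-β)`. -/
def resultantPoly (k : ℕ) (a d D X Y : ℂ) : Polynomial ℂ :=
  Polynomial.C (-(a ^ 2 * X * ((1 - X) * (1 - Y)))) * Polynomial.X ^ (2 * k)
    + Polynomial.C (D * (1 - X * Y) ^ 2 - a * d * (Y * (1 - X) ^ 2 + X * (1 - Y) ^ 2))
      * Polynomial.X ^ k
    + Polynomial.C (-(d ^ 2 * Y * ((1 - X) * (1 - Y))))

theorem natDegree_resultantPoly_le (k : ℕ) (a d D X Y : ℂ) :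
    (resultantPoly k a d D X Y).natDegree ≤ 2 * k := by
  unfold resultantPoly
  refine Polynomial.natDegree_add_le_of_degree_le (Polynomial.natDegree_add_le_of_degree_le
    (Polynomial.natDegree_C_mul_X_pow_le _ _)
    ((Polynomial.natDegree_C_mul_X_pow_le _ _).trans (by omega)))
    ((Polynomial.natDegree_C _).le.trans (Nat.zero_le _))

theorem resultantPoly_ne_zero {k : ℕ} (hk : 0 < k) {a d D X Y : ℂ} (hd : d ≠ 0)
    (hY : Y ≠ 0) (hD : D ≠ a * d) (hXY : ¬(X = 1 ∧ Y = 1)) :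
    resultantPoly k a d D X Y ≠ 0 := by
  intro h
  have h0 := congrArg (fun p => Polynomial.coeff p 0) h
  have h1 := congrArg (fun p => Polynomial.coeff p k) h
  have e1 : k ≠ 2 * k := by omega
  simp only [resultantPoly, Polynomial.coeff_add, Polynomial.coeff_C_mul, Polynomial.coeff_X_pow,
    Polynomial.coeff_C, Polynomial.coeff_zero, if_neg e1, if_neg hk.ne', if_neg hk.ne,
    if_neg (show (0 : ℕ) ≠ 2 * k by omega), if_true, mul_zero, mul_one, zero_add, add_zero,
    neg_eq_zero] at h0 h1
  have hDa := sub_ne_zero.mpr hD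
  have h2 : (1 - X) * (1 - Y) = 0 := by simpa [hd, hY] using h0
  rcases mul_eq_zero.mp h2 with hX | hY1
  · obtain rfl : X = 1 := (sub_eq_zero.mp hX).symm
    have h3 : (D - a * d) * (1 - Y) ^ 2 = 0 := by linear_combination h1
    have h4 : 1 - Y = 0 := by simpa [hDa] using h3
    exact hXY ⟨rfl, (sub_eq_zero.mp h4).symm⟩
  · obtain rfl : Y = 1 := (sub_eq_zero.mp hY1).symm
    have h3 : (D - a * d) * (1 - X) ^ 2 = 0 := by linear_combination h1
    have h4 : 1 - X = 0 := by simpa [hDa] using h3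
    exact hXY ⟨(sub_eq_zero.mp h4).symm, rfl⟩

/-- Two monic quadratics with a common root have vanishing resultant. -/
theorem resultant_eq_zero_of_common_root {t p t' p' l : ℂ} (h : l ^ 2 - t * l + p = 0)
    (h' : l ^ 2 - t' * l + p' = 0) :
    (p - p') ^ 2 - (t - t') * (p * t' - t * p') = 0 := by
  have e : p - p' = (t - t') * l := by linear_combination h - h'
  linear_combination (p - p' + (t - t') * l - t * (t - t')) * e + (t - t') ^ 2 * h

theorem isRoot_resultantPoly {α β : ℕ} {a b c d z w l : ℂ} (hz : z ≠ 0)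
    (hD : a * d - b * c ≠ 0)
    (h : l ∈ spectrum ℂ (!![a * z ^ α, b * z ^ α; c * z⁻¹ ^ β, d * z⁻¹ ^ β] :
      Matrix (Fin 2) (Fin 2) ℂ))
    (h' : l ∈ spectrum ℂ (!![a * (z * w) ^ α, b * (z * w) ^ α;
      c * (z * w)⁻¹ ^ β, d * (z * w)⁻¹ ^ β] : Matrix (Fin 2) (Fin 2) ℂ)) :
    (resultantPoly (α + β) a d (a * d - b * c) (w ^ α) (w⁻¹ ^ β)).IsRoot z := by
  have hr := resultant_eq_zero_of_common_root (charpoly_eq_zero_of_mem_spectrum h)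
    (charpoly_eq_zero_of_mem_spectrum h')
  have hzb : z ^ β * z⁻¹ ^ β = 1 := by rw [← mul_pow, mul_inv_cancel₀ hz, one_pow]
  simp only [mul_inv, mul_pow] at hr
  simp only [resultantPoly, Polynomial.IsRoot, Polynomial.eval_add, Polynomial.eval_mul,
    Polynomial.eval_C, Polynomial.eval_pow, Polynomial.eval_X, mul_comm 2 (α + β), pow_mul,
    pow_add]
  have hx : z ^ α ≠ 0 := pow_ne_zero _ hz
  have hy : z⁻¹ ^ β ≠ 0 := pow_ne_zero _ (inv_ne_zero hz)
  generalize z ^ α = x at *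
  generalize z⁻¹ ^ β = y at *
  generalize z ^ β = v at *
  generalize w ^ α = X at *
  generalize w⁻¹ ^ β = Y at *
  have hv : v = y⁻¹ := eq_inv_of_mul_eq_one_left hzb
  subst hv
  refine (mul_eq_zero.mp (?_ : (a * d - b * c) * x * y ^ 3 * _ = 0)).resolve_left
    (mul_ne_zero (mul_ne_zero hD hx) (pow_ne_zero _ hy))
  field_simp
  linear_combination hr

/-- The number of quasi-momenta at which a shift by `m` repeats an eigenvalue is bounded
uniformly in `m` and `N`. -/
theorem ncard_le_of_common_eigenvalue {α β : ℕ} (hα : 1 ≤ α) (hgcd : Nat.gcd α β = 1)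
    {a b c d : ℂ} (hD : a * d - b * c ≠ 0) (hd : d ≠ 0) (hbc : b * c ≠ 0)
    {N m : ℕ} (hm : 1 ≤ m) (hmN : m < N) {ζ : ℂ} (hζ : IsPrimitiveRoot ζ N)
    {S : Set (Fin N)}
    (hS : ∀ r ∈ S, ∃ l : ℂ,
      l ∈ spectrum ℂ (!![a * (ζ ^ (r : ℕ)) ^ α, b * (ζ ^ (r : ℕ)) ^ α;
        c * (ζ ^ (r : ℕ))⁻¹ ^ β, d * (ζ ^ (r : ℕ))⁻¹ ^ β] : Matrix (Fin 2) (Fin 2) ℂ) ∧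
      l ∈ spectrum ℂ (!![a * (ζ ^ (r : ℕ) * ζ ^ m) ^ α, b * (ζ ^ (r : ℕ) * ζ ^ m) ^ α;
        c * (ζ ^ (r : ℕ) * ζ ^ m)⁻¹ ^ β, d * (ζ ^ (r : ℕ) * ζ ^ m)⁻¹ ^ β] :
        Matrix (Fin 2) (Fin 2) ℂ)) :
    S.ncard ≤ 2 * (α + β) := by
  have hζ0 : ζ ≠ 0 := hζ.ne_zero (by omega)
  have hw1 : ζ ^ m ≠ 1 := hζ.pow_ne_one_of_pos_of_lt (by omega) hmN
  set P := resultantPoly (α + β) a d (a * d - b * c) ((ζ ^ m) ^ α) ((ζ ^ m)⁻¹ ^ β)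
  have hP0 : P ≠ 0 := by
    refine resultantPoly_ne_zero (by omega) hd
      (pow_ne_zero _ (inv_ne_zero (pow_ne_zero _ hζ0))) (by simpa using hbc) ?_
    rintro ⟨h1, h2⟩
    rw [inv_pow, inv_eq_one] at h2
    have h3 := pow_gcd_eq_one.mpr ⟨h1, h2⟩
    rw [hgcd, pow_one] at h3
    exact hw1 h3
  calc S.ncard ≤ (P.roots.toFinset : Set ℂ).ncard := by
        refine Set.ncard_le_ncard_of_injOn (fun r : Fin N => ζ ^ (r : ℕ)) ?_ ?_
          (Finset.finite_toSet _)
        · intro r hr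
          obtain ⟨l, hl, hl'⟩ := hS r hr
          exact Finset.mem_coe.mpr (Multiset.mem_toFinset.mpr ((Polynomial.mem_roots hP0).mpr
            (isRoot_resultantPoly (pow_ne_zero _ hζ0) hD hl hl')))
        · intro r _ s _ hrs
          exact Fin.ext (hζ.pow_inj r.2 s.2 hrs)
    _ = P.roots.toFinset.card := Set.ncard_coe_finset _
    _ ≤ P.roots.card := Multiset.toFinset_card_le _
    _ ≤ P.natDegree := P.card_roots'
    _ ≤ 2 * (α + β) := natDegree_resultantPoly_le _ _ _ _ _ _

theorem exp_eq_pow (N k α : ℕ) :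
    Complex.exp (2 * Real.pi * Complex.I * (((α : ℝ) * ((k : ℝ) / (N : ℝ)) : ℝ) : ℂ)) =
      (Complex.exp (2 * Real.pi * Complex.I / N) ^ k) ^ α := by
  rw [← Complex.exp_nat_mul, ← Complex.exp_nat_mul]
  congr 1
  push_cast
  ring

theorem exp_neg_eq_inv_pow (N k β : ℕ) :
    Complex.exp (-(2 * Real.pi * Complex.I) * (((β : ℝ) * ((k : ℝ) / (N : ℝ)) : ℝ) : ℂ)) =
      (Complex.exp (2 * Real.pi * Complex.I / N) ^ k)⁻¹ ^ β := by
  rw [inv_pow, ← exp_eq_pow, neg_mul, Complex.exp_neg]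

/-- **NRG for two-state coined walks with coprime step sizes and nonvanishing coin.**
If the coin `[[a,b],[c,d]]` is unitary with `abcd ≠ 0` and `gcd(α,β) = 1`, then the
Floquet matrix of the coined walk with steps `−α, β` satisfies the spectral NRG
condition. -/
theorem coined_walk_NRG
    (α β : ℕ) (hα : 1 ≤ α) (hβ : 1 ≤ β) (hgcd : Nat.gcd α β = 1)
    (a b c d : ℂ)
    (hUnitary : (!![a, b; c, d] : Matrix (Fin 2) (Fin 2) ℂ) ∈ Matrix.unitaryGroup (Fin 2) ℂ)
    (habcd : a * b * c * d ≠ 0) :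
    SpectralNRG (fun θ : ℝ =>
      (!![a * Complex.exp (2 * Real.pi * Complex.I * (((α : ℝ) * θ : ℝ) : ℂ)),
          b * Complex.exp (2 * Real.pi * Complex.I * (((α : ℝ) * θ : ℝ) : ℂ));
          c * Complex.exp (-(2 * Real.pi * Complex.I) * (((β : ℝ) * θ : ℝ) : ℂ)),
          d * Complex.exp (-(2 * Real.pi * Complex.I) * (((β : ℝ) * θ : ℝ) : ℂ))] :
        Matrix (Fin 2) (Fin 2) ℂ)) := by
  have hbc : b * c ≠ 0 := fun h => habcd (by linear_combination a * d * h)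
  have hd : d ≠ 0 := right_ne_zero_of_mul habcd
  have hD : a * d - b * c ≠ 0 := by
    have h := (Matrix.isUnit_iff_isUnit_det _).mp
      (Unitary.isUnit_coe (U := (⟨_, hUnitary⟩ : Matrix.unitaryGroup (Fin 2) ℂ)))
    simpa [Matrix.det_fin_two] using h.ne_zero
  intro ε hε
  obtain ⟨N₀, hN₀⟩ := exists_nat_gt (((2 * (α + β) : ℕ) : ℝ) / ε)
  refine ⟨N₀, fun N hN m hm hmN => ?_⟩
  have hNpos : (0 : ℝ) < N := by exact_mod_cast (by omega : 0 < N)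
  have hNN : (N₀ : ℝ) ≤ N := by exact_mod_cast hN
  rw [div_lt_iff₀ hNpos]
  refine lt_of_le_of_lt (Nat.cast_le.mpr (ncard_le_of_common_eigenvalue hα hgcd hD hd hbc hm hmN
    (Complex.isPrimitiveRoot_exp N (by omega)) ?_)) (?_ : ((2 * (α + β) : ℕ) : ℝ) < ε * N)
  · rintro r ⟨l, hl', hl⟩
    simp only [exp_eq_pow, exp_neg_eq_inv_pow, pow_add _ (r : ℕ) m] at hl hl'
    exact ⟨l, hl, hl'⟩
  · rw [div_lt_iff₀ hε] at hN₀
    nlinarith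

end QW1
end
end

section
/- Let a,b,c,d ∈ ℂ be such that the 2×2 matrix [[a,b],[c,d]] is unitary and a·b·c·d ≠ 0. Define the Floquet matrix Û(θ) = [[c·exp(−2πi θ), d·exp(−2πi θ)],[a·exp(2πi θ), b·exp(2πi θ)]] for θ ∈ ℝ (the Floquet matrix of the homogeneous arc-reversal quantum walk U = [[c·S₁, d·S₁],[a·S₋₁, b·S₋₁]] on ℤ). Then the spectral NRG condition holds: max over m ∈ {1,…,N−1} of N^{−1}·#{r ∈ {0,…,N−1} : spectrum(Û((r+m)/N)) ∩ spectrum(Û(r/N)) ≠ ∅} tends to 0 as N → ∞. -/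
open Filter

noncomputable section

namespace QW1

/-- Two complex 2×2 matrices with a common eigenvalue and the same nonzero determinant have the
same trace. -/
theorem trace_eq_of_mem_spectrum {A B : Matrix (Fin 2) (Fin 2) ℂ} {x : ℂ} (hdet : A.det = B.det)
    (h0 : B.det ≠ 0) (hA : x ∈ spectrum ℂ A) (hB : x ∈ spectrum ℂ B) : A.trace = B.trace := by
  have char (M : Matrix (Fin 2) (Fin 2) ℂ) (hM : x ∈ spectrum ℂ M) :
      x ^ 2 - M.trace * x + M.det = 0 := by
    simpa [Matrix.charpoly_fin_two, Polynomial.IsRoot] using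
      Matrix.mem_spectrum_iff_isRoot_charpoly.mp hM
  have h1 := char A hA
  have h2 := char B hB
  have hx : x ≠ 0 := by
    rintro rfl
    exact h0 (by simpa using h2)
  refine mul_right_cancel₀ hx ?_
  rw [hdet] at h1
  linear_combination h2 - h1

/-- The injective image in `ℂ` of `s` lies on the square roots of `w`, so `s` has at most two
elements. -/
theorem ncard_le_two_of_sq_eq {α : Type*} {s : Set α} {f : α → ℂ} (hf : s.InjOn f) {w : ℂ}
    (hw : ∀ r ∈ s, f r ^ 2 = w) : s.ncard ≤ 2 := by
  obtain ⟨t, rfl⟩ := IsAlgClosed.exists_pow_nat_eq w (n := 2) two_pos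
  refine (Set.ncard_le_ncard_of_injOn (t := {t, -t}) f (fun r hr => ?_) hf).trans
    ((Set.ncard_insert_le _ _).trans_eq (by rw [Set.ncard_singleton]))
  simpa using sq_eq_sq_iff_eq_or_eq_neg.mp (hw r hr)

/-- The arc-reversal Floquet matrix, as a function of the phase `z`. -/
def arcReversal (a b c d z : ℂ) : Matrix (Fin 2) (Fin 2) ℂ :=
  !![c * z⁻¹, d * z⁻¹; a * z, b * z]

theorem det_arcReversal (a b c d : ℂ) {z : ℂ} (hz : z ≠ 0) :
    (arcReversal a b c d z).det = c * b - d * a := by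
  rw [arcReversal, Matrix.det_fin_two_of]
  field_simp

theorem mul_eq_div_of_mem_spectrum {a b c d z w x : ℂ} (hb : b ≠ 0) (hdet : a * d - b * c ≠ 0)
    (hz : z ≠ 0) (hw : w ≠ 0) (hzw : z ≠ w) (hxz : x ∈ spectrum ℂ (arcReversal a b c d z))
    (hxw : x ∈ spectrum ℂ (arcReversal a b c d w)) : z * w = c / b := by
  have htr := trace_eq_of_mem_spectrum
    ((det_arcReversal a b c d hz).trans (det_arcReversal a b c d hw).symm)
    (by rw [det_arcReversal a b c d hw]; contrapose! hdet; linear_combination -hdet) hxz hxw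
  simp only [arcReversal, Matrix.trace_fin_two_of] at htr
  field_simp at htr
  rw [eq_div_iff hb]
  refine mul_right_cancel₀ (sub_ne_zero.mpr hzw) ?_
  linear_combination htr

/-- **NRG for the homogeneous arc-reversal walk on ℤ.** If the coin `[[a,b],[c,d]]` is
unitary with `abcd ≠ 0`, the Floquet matrix of the arc-reversal walk satisfies the
spectral NRG condition. -/
theorem arc_reversal_NRG
    (a b c d : ℂ)
    (hUnitary : (!![a, b; c, d] : Matrix (Fin 2) (Fin 2) ℂ) ∈ Matrix.unitaryGroup (Fin 2) ℂ)
    (habcd : a * b * c * d ≠ 0) :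
    SpectralNRG (fun θ : ℝ =>
      (!![c * Complex.exp (-(2 * Real.pi * Complex.I) * ((θ : ℝ) : ℂ)),
          d * Complex.exp (-(2 * Real.pi * Complex.I) * ((θ : ℝ) : ℂ));
          a * Complex.exp (2 * Real.pi * Complex.I * ((θ : ℝ) : ℂ)),
          b * Complex.exp (2 * Real.pi * Complex.I * ((θ : ℝ) : ℂ))] :
        Matrix (Fin 2) (Fin 2) ℂ)) := by
  have hb : b ≠ 0 := by
    rintro rfl
    simp at habcd
  have hdet : a * d - b * c ≠ 0 := by
    rw [← Matrix.det_fin_two_of]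
    exact ((Matrix.isUnit_iff_isUnit_det _).mp (Unitary.toUnits ⟨_, hUnitary⟩).isUnit).ne_zero
  intro ε hε
  obtain ⟨N₀, hN₀⟩ := exists_nat_gt (2 / ε)
  refine ⟨N₀, fun N hN m hm hmN => ?_⟩
  have hNpos : 0 < N := by omega
  have hζ := Complex.isPrimitiveRoot_exp N hNpos.ne'
  set ζ := Complex.exp (2 * Real.pi * Complex.I / N) with hζdef
  have hζ0 : ζ ≠ 0 := Complex.exp_ne_zero _
  have hexp (k : ℕ) :
      Complex.exp (2 * Real.pi * Complex.I * (((k : ℝ) / (N : ℝ) : ℝ) : ℂ)) = ζ ^ k := by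
    rw [hζdef, ← Complex.exp_nat_mul]
    congr 1
    push_cast
    ring
  have hcard := ncard_le_two_of_sq_eq (f := fun r : Fin N => ζ ^ (r : ℕ))
    (w := c / b / ζ ^ m) (s := {r : Fin N |
      (spectrum ℂ (arcReversal a b c d (ζ ^ ((r : ℕ) + m))) ∩
       spectrum ℂ (arcReversal a b c d (ζ ^ (r : ℕ)))).Nonempty})
    (fun r _ r' _ h => Fin.ext (hζ.pow_inj r.2 r'.2 h)) (by
      rintro r ⟨x, hx, hx'⟩
      have hne : ζ ^ ((r : ℕ) + m) ≠ ζ ^ (r : ℕ) := by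
        rw [pow_add]
        exact fun h => hζ.pow_ne_one_of_pos_of_lt (by omega) hmN
          (mul_left_cancel₀ (pow_ne_zero _ hζ0) (h.trans (mul_one _).symm))
      rw [← mul_eq_div_of_mem_spectrum hb hdet (pow_ne_zero _ hζ0) (pow_ne_zero _ hζ0) hne hx hx',
        eq_div_iff (pow_ne_zero _ hζ0)]
      ring)
  simp only [neg_mul, Complex.exp_neg, hexp]
  have hNR : (0 : ℝ) < N := by exact_mod_cast hNpos
  have hlt : 2 / ε < N := hN₀.trans_le (by exact_mod_cast hN)
  rw [div_lt_iff₀ hε] at hlt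
  rw [div_lt_iff₀ hNR, mul_comm]
  refine lt_of_le_of_lt ?_ hlt
  exact_mod_cast hcard

end QW1
end
end

section
/- The polynomial P in three variables z₁, z₂, λ over ℂ given by P = (−16i − 8(1−i)λ² + 16λ⁴)·z₁z₂ + (8λ − 8λ³)·z₂ + (8iλ − 8iλ³)·z₁²z₂ + (8λ − 8λ³)·z₁ + (8iλ − 8iλ³)·z₁z₂² − 4(1−i)λ²·z₁² − 4(1−i)λ²·z₂² is irreducible in the polynomial ring ℂ[z₁, z₂, λ] (i.e. as an element of MvPolynomial (Fin 3) ℂ). -/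
open MvPolynomial

noncomputable section

/-- The polynomial `z₁z₂ · det(2Û(z) − 2λ·I)` associated with the two-dimensional
Fourier-coined quantum walk, with `z₁ = X 0`, `z₂ = X 1`, `λ = X 2`. -/
def fourierWalkPoly : MvPolynomial (Fin 3) ℂ :=
  (C (-16 * Complex.I) - C (8 * (1 - Complex.I)) * X 2 ^ 2 + C 16 * X 2 ^ 4) * (X 0 * X 1)
  + (C 8 * X 2 - C 8 * X 2 ^ 3) * X 1
  + (C (8 * Complex.I) * X 2 - C (8 * Complex.I) * X 2 ^ 3) * (X 0 ^ 2 * X 1)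
  + (C 8 * X 2 - C 8 * X 2 ^ 3) * X 0
  + (C (8 * Complex.I) * X 2 - C (8 * Complex.I) * X 2 ^ 3) * (X 0 * X 1 ^ 2)
  - C (4 * (1 - Complex.I)) * X 2 ^ 2 * X 0 ^ 2
  - C (4 * (1 - Complex.I)) * X 2 ^ 2 * X 1 ^ 2

/-- A quadratic polynomial over a domain is irreducible as soon as its coefficients have no common
non-unit divisor and its discriminant is not a square. -/
theorem irreducible_quadratic_of_not_isSquare_discrim {R : Type*} [CommRing R] [IsDomain R]
    {a b c : R} (ha : a ≠ 0) (hprim : ∀ r, r ∣ a → r ∣ b → r ∣ c → IsUnit r)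
    (hsq : ¬ IsSquare (discrim a b c)) :
    Irreducible (.C a * .X ^ 2 + .C b * .X + .C c : Polynomial R) := by
  have isUnit_of_natDegree_eq_zero : ∀ g h : Polynomial R,
      .C a * .X ^ 2 + .C b * .X + .C c = g * h → g.natDegree = 0 → IsUnit g := by
    intro g h hgh hg
    rw [Polynomial.eq_C_of_natDegree_eq_zero hg] at hgh ⊢
    have hdvd := (Polynomial.C_dvd_iff_dvd_coeff _ _).1 (Dvd.intro _ hgh.symm)
    refine (hprim _ ?_ ?_ ?_).map Polynomial.C
    · simpa [Polynomial.coeff_X, Polynomial.coeff_C] using hdvd 2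
    · simpa [Polynomial.coeff_X, Polynomial.coeff_C] using hdvd 1
    · simpa [Polynomial.coeff_X, Polynomial.coeff_C] using hdvd 0
  have hdeg := Polynomial.natDegree_quadratic (b := b) (c := c) ha
  have hne : (.C a * .X ^ 2 + .C b * .X + .C c : Polynomial R) ≠ 0 := by
    rintro h
    simp [h] at hdeg
  refine ⟨fun hu => ?_, fun g h hgh => ?_⟩
  · simp [Polynomial.natDegree_eq_zero_of_isUnit hu] at hdeg
  · have hmul : g.natDegree + h.natDegree = 2 := by
      rw [← hdeg, hgh, Polynomial.natDegree_mul] <;> rintro rfl <;> simp [hne] at hgh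
    rcases Nat.eq_zero_or_pos g.natDegree with hg | hg
    · exact .inl (isUnit_of_natDegree_eq_zero g h hgh hg)
    rcases Nat.eq_zero_or_pos h.natDegree with hh | hh
    · exact .inr (isUnit_of_natDegree_eq_zero h g (hgh.trans (mul_comm g h)) hh)
    obtain ⟨a₁, b₁, rfl⟩ := Polynomial.exists_eq_X_add_C_of_natDegree_le_one
      (show g.natDegree ≤ 1 by lia)
    obtain ⟨a₂, b₂, rfl⟩ := Polynomial.exists_eq_X_add_C_of_natDegree_le_one
      (show h.natDegree ≤ 1 by lia)
    replace hgh : (.C a * .X ^ 2 + .C b * .X + .C c : Polynomial R) =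
        .C (a₁ * a₂) * .X ^ 2 + .C (a₁ * b₂ + b₁ * a₂) * .X + .C (b₁ * b₂) := by
      rw [hgh]
      simp only [map_add, map_mul]
      ring
    have h₂ := congrArg (Polynomial.coeff · 2) hgh
    have h₁ := congrArg (Polynomial.coeff · 1) hgh
    have h₀ := congrArg (Polynomial.coeff · 0) hgh
    simp [Polynomial.coeff_X, Polynomial.coeff_C, -map_mul] at h₂ h₁ h₀
    refine absurd ⟨a₁ * b₂ - b₁ * a₂, ?_⟩ hsq
    rw [discrim, h₂, h₁, h₀]
    ring

/-- A square in `K[X]` has no simple roots. -/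
theorem Polynomial.not_isSquare_of_simple_root {K : Type*} [Field K] {f : Polynomial K} {x : K}
    (hf : f.IsRoot x) (hf' : ¬ f.derivative.IsRoot x) : ¬ IsSquare f := by
  rintro ⟨g, rfl⟩
  have hg : g.eval x = 0 := by simpa using hf
  simp [hg] at hf'

namespace FourierWalk

/-- The leading coefficient of `fourierWalkPoly` as a quadratic polynomial in `z₁`. -/
def coeffTwo : Polynomial (MvPolynomial (Fin 1) ℂ) :=
  .C (8 * C Complex.I * (X 0 - X 0 ^ 3)) * .X + .C (-(4 * (1 - C Complex.I) * X 0 ^ 2))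

/-- The linear coefficient of `fourierWalkPoly` as a quadratic polynomial in `z₁`. -/
def coeffOne : Polynomial (MvPolynomial (Fin 1) ℂ) :=
  .C (8 * C Complex.I * (X 0 - X 0 ^ 3)) * .X ^ 2 +
    .C (-16 * C Complex.I - 8 * (1 - C Complex.I) * X 0 ^ 2 + 16 * X 0 ^ 4) * .X +
    .C (8 * (X 0 - X 0 ^ 3))

/-- The constant coefficient of `fourierWalkPoly` as a quadratic polynomial in `z₁`. -/
def coeffZero : Polynomial (MvPolynomial (Fin 1) ℂ) :=
  .C (-(4 * (1 - C Complex.I) * X 0 ^ 2)) * .X ^ 2 + .C (8 * (X 0 - X 0 ^ 3)) * .X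

/-- The identification `ℂ[z₁, z₂, λ] ≃ ℂ[λ][z₂][z₁]`. -/
def iteratedEquiv :
    MvPolynomial (Fin 3) ℂ ≃ₐ[ℂ] Polynomial (Polynomial (MvPolynomial (Fin 1) ℂ)) :=
  (finSuccEquiv ℂ 2).trans (Polynomial.mapAlgEquiv (finSuccEquiv ℂ 1))

theorem iteratedEquiv_fourierWalkPoly :
    iteratedEquiv fourierWalkPoly =
      .C coeffTwo * .X ^ 2 + .C coeffOne * .X + .C coeffZero := by
  have hC (a : ℂ) : iteratedEquiv (C a) = .C (.C (C a)) := by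
    simp [iteratedEquiv, finSuccEquiv_apply]
  have hX₀ : iteratedEquiv (X 0) = .X := by
    simp [iteratedEquiv, finSuccEquiv_X_zero]
  have hX₁ : iteratedEquiv (X 1) = .C .X := by
    have := finSuccEquiv_X_succ (R := ℂ) (n := 2) (j := 0)
    rw [Fin.succ_zero_eq_one] at this
    simp [iteratedEquiv, this, finSuccEquiv_X_zero]
  have hX₂ : iteratedEquiv (X 2) = .C (.C (X 0)) := by
    have h := finSuccEquiv_X_succ (R := ℂ) (n := 2) (j := 1)
    have h' := finSuccEquiv_X_succ (R := ℂ) (n := 1) (j := 0)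
    rw [Fin.succ_one_eq_two] at h
    rw [Fin.succ_zero_eq_one] at h'
    simp [iteratedEquiv, h, h']
  simp only [fourierWalkPoly, coeffTwo, coeffOne, coeffZero, map_add, map_sub, map_mul, map_pow,
    map_neg, map_one, map_ofNat, hX₀, hX₁, hX₂, hC]
  ring

theorem leadingCoeff_ne_zero :
    (8 * C Complex.I * (X 0 - X 0 ^ 3) : MvPolynomial (Fin 1) ℂ) ≠ 0 := by
  intro h
  have := congrArg (eval fun _ => 2) h
  norm_num at this

theorem coeffTwo_ne_zero : coeffTwo ≠ 0 := by
  intro h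
  have := congrArg (Polynomial.coeff · 1) h
  simp only [coeffTwo, Polynomial.coeff_add, Polynomial.coeff_C_mul, Polynomial.coeff_X_one,
    Polynomial.coeff_C_succ, Polynomial.coeff_zero, mul_one, add_zero] at this
  exact leadingCoeff_ne_zero this

theorem isUnit_of_dvd_coeffs (r : Polynomial (MvPolynomial (Fin 1) ℂ)) (h₂ : r ∣ coeffTwo)
    (h₁ : r ∣ coeffOne) (h₀ : r ∣ coeffZero) : IsUnit r := by
  let φ : MvPolynomial (Fin 1) ℂ →+* ℂ := eval fun _ => 2
  have hlead : φ r.leadingCoeff ≠ 0 := by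
    have hdvd : r.leadingCoeff ∣ 8 * C Complex.I * (X 0 - X 0 ^ 3) := by
      obtain ⟨s, hs⟩ := h₂
      refine ⟨s.leadingCoeff, ?_⟩
      rw [← Polynomial.leadingCoeff_mul, ← hs, coeffTwo,
        Polynomial.leadingCoeff_linear leadingCoeff_ne_zero]
    refine ne_zero_of_dvd_ne_zero ?_ (map_dvd φ hdvd)
    norm_num [φ]
  have hmap : IsUnit (r.map φ) := by
    have d₂ := Polynomial.map_dvd φ h₂
    have d₀ := Polynomial.map_dvd φ h₀
    have hI : (Polynomial.C Complex.I) ^ 2 = -1 := by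
      rw [← map_pow, Complex.I_sq, map_neg, map_one]
    have hcomb : Polynomial.C (-176 * (1 + Complex.I)) = coeffZero.map φ * 9 +
        coeffTwo.map φ * (3 * (1 + .C Complex.I) * .X + 11 * .C Complex.I) := by
      simp only [φ, coeffTwo, coeffZero, Polynomial.map_add, Polynomial.map_mul,
        Polynomial.map_pow, Polynomial.map_X, Polynomial.map_C]
      simp only [map_add, map_sub, map_mul, map_neg, map_pow, map_one, map_ofNat, eval_C, eval_X]
      linear_combination (144 * Polynomial.X ^ 2 + 480 * Polynomial.X - 176) * hI
    have hunit : IsUnit (-176 * (1 + Complex.I)) := by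
      simp [Complex.ext_iff]
    refine isUnit_of_dvd_unit ?_ (hunit.map Polynomial.C)
    rw [hcomb]
    exact dvd_add (d₀.mul_right _) (d₂.mul_right _)
  have hdeg : r.natDegree = 0 := by
    rw [← Polynomial.natDegree_map_of_leadingCoeff_ne_zero φ hlead]
    exact Polynomial.natDegree_eq_zero_of_isUnit hmap
  rw [Polynomial.eq_C_of_natDegree_eq_zero hdeg] at h₂ h₁ ⊢
  refine IsUnit.map Polynomial.C ?_
  generalize r.coeff 0 = s at h₁ h₂
  rw [Polynomial.C_dvd_iff_dvd_coeff] at h₂ h₁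
  have e₂ : s ∣ -(4 * (1 - C Complex.I) * X 0 ^ 2) := by
    simpa only [coeffTwo, Polynomial.coeff_add, Polynomial.coeff_C_mul, Polynomial.coeff_X_zero,
      Polynomial.coeff_C_zero, mul_zero, zero_add] using h₂ 0
  have e₁ : s ∣ -16 * C Complex.I - 8 * (1 - C Complex.I) * X 0 ^ 2 + 16 * X 0 ^ 4 := by
    simpa only [coeffOne, Polynomial.coeff_add, Polynomial.coeff_C_mul, Polynomial.coeff_X_one,
      Polynomial.coeff_X_pow, Polynomial.coeff_C_succ, OfNat.one_ne_ofNat, if_false, mul_zero,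
      mul_one, zero_add, add_zero] using h₁ 1
  have hI : (C Complex.I : MvPolynomial (Fin 1) ℂ) ^ 2 = -1 := by
    rw [← map_pow, Complex.I_sq, map_neg, map_one]
  have hcomb : C (-16 * Complex.I) =
      (-16 * C Complex.I - 8 * (1 - C Complex.I) * X 0 ^ 2 + 16 * X 0 ^ 4) +
        -(4 * (1 - C Complex.I) * X 0 ^ 2) *
          (2 * (1 + C Complex.I) * X 0 ^ 2 - 2 : MvPolynomial (Fin 1) ℂ) := by
    simp only [map_mul, map_neg, map_ofNat]
    linear_combination (-8 * X 0 ^ 4) * hI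
  have hunit : IsUnit (-16 * Complex.I) := by simp
  refine isUnit_of_dvd_unit ?_ (hunit.map C)
  rw [hcomb]
  exact dvd_add e₁ (e₂.mul_right _)

theorem not_isSquare_discrim : ¬ IsSquare (discrim coeffTwo coeffOne coeffZero) := by
  let φ : Polynomial (MvPolynomial (Fin 1) ℂ) →+* Polynomial ℂ :=
    Polynomial.eval₂RingHom (eval₂Hom Polynomial.C fun _ => Polynomial.X) (-1)
  have hφ : φ (discrim coeffTwo coeffOne coeffZero) = discrim
      (-(8 * .C Complex.I * (.X - .X ^ 3)) - 4 * (1 - .C Complex.I) * .X ^ 2)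
      (8 * .C Complex.I * (.X - .X ^ 3) -
        (-16 * .C Complex.I - 8 * (1 - .C Complex.I) * .X ^ 2 + 16 * .X ^ 4) +
        8 * (.X - .X ^ 3))
      (-(4 * (1 - .C Complex.I) * .X ^ 2) - 8 * (.X - .X ^ 3)) := by
    have hC (p : MvPolynomial (Fin 1) ℂ) :
        φ (.C p) = eval₂Hom Polynomial.C (fun _ => Polynomial.X) p :=
      Polynomial.eval₂_C ..
    have hX : φ .X = -1 := Polynomial.eval₂_X ..
    simp only [discrim, coeffTwo, coeffOne, coeffZero, map_add φ, map_sub φ, map_mul φ, map_pow φ,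
      map_ofNat φ, hC, hX]
    simp only [map_add, map_sub, map_mul, map_neg, map_pow, map_one, map_ofNat, eval₂Hom_C,
      eval₂Hom_X']
    ring
  refine fun h => Polynomial.not_isSquare_of_simple_root (x := 1) ?_ ?_ (h.map φ)
  · rw [hφ, discrim]
    simp
    ring
  · rw [hφ, discrim]
    simp [Polynomial.derivative_pow]
    ring_nf
    simp

end FourierWalk

/-- **Irreducibility of the Bloch polynomial of the 2d Fourier walk.** -/
theorem fourierWalkPoly_irreducible : Irreducible fourierWalkPoly := by
  rw [← MulEquiv.irreducible_iff FourierWalk.iteratedEquiv,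
    FourierWalk.iteratedEquiv_fourierWalkPoly]
  exact irreducible_quadratic_of_not_isSquare_discrim FourierWalk.coeffTwo_ne_zero
    FourierWalk.isUnit_of_dvd_coeffs FourierWalk.not_isSquare_discrim
end
end

section
/- Let Û(θ₁,θ₂) be the 4×4 complex matrix (1/2)·[[exp(−2πi θ₁), exp(−2πi θ₁), exp(−2πi θ₁), exp(−2πi θ₁)],[exp(2πi θ₁), i·exp(2πi θ₁), −exp(2πi θ₁), −i·exp(2πi θ₁)],[exp(−2πi θ₂), −exp(−2πi θ₂), exp(−2πi θ₂), −exp(−2πi θ₂)],[exp(2πi θ₂), −i·exp(2πi θ₂), −exp(2πi θ₂), i·exp(2πi θ₂)]], the Floquet matrix of the Fourier-coined quantum walk on ℤ². Then the spectral NRG condition holds: max over nonzero m ∈ {0,…,N−1}² of N^{−2}·#{r ∈ {0,…,N−1}² : spectrum(Û((r₁+m₁)/N, (r₂+m₂)/N)) ∩ spectrum(Û(r₁/N, r₂/N)) ≠ ∅} tends to 0 as N → ∞. -/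
open Filter

noncomputable section

namespace QW

/-- Spectral "No Repeating Graphs" condition in dimension `d`. -/
def SpectralNRG (d : ℕ) {ι : Type*} [Fintype ι] [DecidableEq ι]
    (U : (Fin d → ℝ) → Matrix ι ι ℂ) : Prop :=
  ∀ ε : ℝ, 0 < ε → ∃ N₀ : ℕ, ∀ N : ℕ, N₀ ≤ N → ∀ m : Fin d → ℕ,
    (∀ l, m l < N) → m ≠ 0 →
    ((Set.ncard {r : Fin d → Fin N |
      (spectrum ℂ (U fun l => (((r l : ℕ) + m l : ℕ) : ℝ) / (N : ℝ)) ∩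
       spectrum ℂ (U fun l => ((r l : ℕ) : ℝ) / (N : ℝ))).Nonempty}) : ℝ) / (N : ℝ) ^ d < ε

/-- `e(x) = exp(2πi x)`. -/
def ee (x : ℝ) : ℂ := Complex.exp (2 * Real.pi * Complex.I * (x : ℂ))

/-- The Floquet matrix of the Fourier-coined quantum walk on `ℤ²`. -/
def fourierFloquet (θ : Fin 2 → ℝ) : Matrix (Fin 4) (Fin 4) ℂ :=
  (1 / 2 : ℂ) •
    (!![ee (-(θ 0)), ee (-(θ 0)), ee (-(θ 0)), ee (-(θ 0));
        ee (θ 0), Complex.I * ee (θ 0), -ee (θ 0), -Complex.I * ee (θ 0);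
        ee (-(θ 1)), -ee (-(θ 1)), ee (-(θ 1)), -ee (-(θ 1));
        ee (θ 1), -Complex.I * ee (θ 1), -ee (θ 1), Complex.I * ee (θ 1)] :
      Matrix (Fin 4) (Fin 4) ℂ)

lemma ee_add (x y : ℝ) : ee (x + y) = ee x * ee y := by
  unfold ee
  rw [← Complex.exp_add]
  congr 1
  push_cast
  ring

lemma ee_ne_zero (x : ℝ) : ee x ≠ 0 := Complex.exp_ne_zero _

lemma ee_neg (x : ℝ) : ee (-x) = (ee x)⁻¹ := by
  unfold ee
  rw [← Complex.exp_neg]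
  congr 1
  push_cast
  ring

lemma ee_eq_one_iff (x : ℝ) : ee x = 1 ↔ ∃ n : ℤ, x = n := by
  unfold ee
  rw [Complex.exp_eq_one_iff]
  have h : (2 * Real.pi * Complex.I : ℂ) ≠ 0 := Complex.two_pi_I_ne_zero
  refine exists_congr fun n => ?_
  rw [mul_comm (n : ℂ), mul_right_inj' h]
  exact_mod_cast Iff.rfl

lemma ee_natCast_div_eq_one {N k : ℕ} (hk : k < N) (h : ee ((k : ℝ) / N) = 1) : k = 0 := by
  obtain ⟨n, hn⟩ := (ee_eq_one_iff _).1 h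
  have hN : (0 : ℝ) < N := by exact_mod_cast Nat.zero_lt_of_lt hk
  rw [div_eq_iff hN.ne'] at hn
  have hn' : (k : ℤ) = n * N := by exact_mod_cast hn
  have h1 : n < 1 := by
    by_contra! hc
    nlinarith
  have h2 : 0 ≤ n := by
    by_contra! hc
    nlinarith
  have h3 : n = 0 := by omega
  subst h3
  simpa using hn'

lemma ee_natCast_div_injective (N : ℕ) :
    Function.Injective fun k : Fin N => ee (((k : ℕ) : ℝ) / N) := by
  suffices key : ∀ j k : Fin N, (j : ℕ) ≤ k →
      ee (((j : ℕ) : ℝ) / N) = ee (((k : ℕ) : ℝ) / N) → j = k by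
    intro j k h
    rcases le_total (j : ℕ) k with hjk | hjk
    · exact key j k hjk h
    · exact (key k j hjk h.symm).symm
  intro j k hjk h
  have hs : ((k : ℕ) : ℝ) / N = ((j : ℕ) : ℝ) / N + ((k - j : ℕ) : ℝ) / N := by
    push_cast [hjk]
    ring
  rw [hs, ee_add] at h
  have h1 : ee (((k - j : ℕ) : ℝ) / N) = 1 := by
    have := ee_ne_zero (((j : ℕ) : ℝ) / N)
    exact mul_left_cancel₀ this (by rw [← h, mul_one])
  have := ee_natCast_div_eq_one (lt_of_le_of_lt (Nat.sub_le _ _) k.isLt) h1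
  ext
  omega

lemma ee_natCast_div_pow {N : ℕ} (hN : N ≠ 0) (k : ℕ) : ee ((k : ℝ) / N) ^ N = 1 := by
  unfold ee
  rw [← Complex.exp_nat_mul, Complex.exp_eq_one_iff]
  refine ⟨k, ?_⟩
  have : (N : ℂ) ≠ 0 := by exact_mod_cast hN
  push_cast
  field_simp

/-- The characteristic equation of the Fourier walk. -/
lemma charpoly_eq_zero_of_mem_spectrum {θ : Fin 2 → ℝ} {z w l : ℂ}
    (hz : ee (θ 0) = z) (hw : ee (θ 1) = w)
    (hl : l ∈ spectrum ℂ (fourierFloquet θ)) :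
    l ^ 4 - Complex.I + (Complex.I - 1) / 4 * ((z + w) ^ 2 / (z * w)) * l ^ 2
      - (z⁻¹ + Complex.I * z + w⁻¹ + Complex.I * w) / 2 * (l * (l ^ 2 - 1)) = 0 := by
  have hz0 : z ≠ 0 := hz ▸ ee_ne_zero _
  have hw0 : w ≠ 0 := hw ▸ ee_ne_zero _
  rw [Matrix.mem_spectrum_iff_isRoot_charpoly, Polynomial.IsRoot.def, Matrix.eval_charpoly] at hl
  rw [← hl]
  unfold fourierFloquet
  simp only [ee_neg, hz, hw]
  simp [Matrix.det_succ_row_zero, Fin.sum_univ_succ, Fin.succAbove, Matrix.scalar_apply]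
  field_simp
  ring_nf

/-- The eliminant of two characteristic equations sharing the root `l`. -/
lemma eliminant_eq_zero {l E T E' T' : ℂ}
    (h : l ^ 4 - Complex.I + E * l ^ 2 - T * (l * (l ^ 2 - 1)) = 0)
    (h' : l ^ 4 - Complex.I + E' * l ^ 2 - T' * (l * (l ^ 2 - 1)) = 0) :
    2 * Complex.I * (T - T') ^ 4
      + ((E - E') ^ 2 + 2 * (T - T') ^ 2 + (E * (T - T') ^ 2 - T * (E - E') * (T - T')))
        * ((E * (T - T') ^ 2 - T * (E - E') * (T - T'))
            - Complex.I * ((E - E') ^ 2 + 2 * (T - T') ^ 2)) = 0 := by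
  have hl : l ≠ 0 := by
    rintro rfl
    simp at h
  have hI := Complex.I_sq
  obtain ⟨p, hp⟩ : ∃ p, p = E - E' := ⟨_, rfl⟩
  obtain ⟨q, hq⟩ : ∃ q, q = T - T' := ⟨_, rfl⟩
  rw [← hp, ← hq]
  have h1 : p * l = q * (l ^ 2 - 1) := by
    apply mul_left_cancel₀ hl
    rw [hp, hq]
    linear_combination h - h'
  have h2 : q ^ 2 * (l ^ 4 + 1) = (p ^ 2 + 2 * q ^ 2) * l ^ 2 := by
    linear_combination (-(p * l) - q * (l ^ 2 - 1)) * h1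
  have h3 : q ^ 2 * (l ^ 4 - Complex.I) = -(E * q ^ 2 - T * p * q) * l ^ 2 := by
    linear_combination q ^ 2 * h - T * q * l * h1
  obtain ⟨M, hM⟩ : ∃ M, M = p ^ 2 + 2 * q ^ 2 := ⟨_, rfl⟩
  obtain ⟨K, hK⟩ : ∃ K, K = E * q ^ 2 - T * p * q := ⟨_, rfl⟩
  rw [← hM] at h2 ⊢
  rw [← hK] at h3 ⊢
  have h4 : q ^ 2 * (1 + Complex.I) = (M + K) * l ^ 2 := by
    linear_combination h2 - h3
  have h5 : q ^ 2 * (1 + Complex.I) * l ^ 2 = Complex.I * M - K := by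
    apply mul_left_cancel₀ (pow_ne_zero 2 hl)
    linear_combination Complex.I * h2 + h3
  apply mul_left_cancel₀ (pow_ne_zero 2 hl)
  linear_combination (Complex.I * M - K) * h4 + q ^ 2 * (1 + Complex.I) * h5
    - q ^ 4 * l ^ 2 * hI

open Polynomial in
/-- The eliminant as a polynomial in `z ^ 2` along a line of constant ratio `w / z`. -/
def lineEliminant (p E q₁ q₀ T₁ T₀ : ℂ) : ℂ[X] :=
  C (2 * Complex.I) * (C q₁ * X + C q₀) ^ 4
    + ((C (p ^ 2) * X + 2 * (C q₁ * X + C q₀) ^ 2)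
        + (C E * (C q₁ * X + C q₀) ^ 2 - C p * (C T₁ * X + C T₀) * (C q₁ * X + C q₀)))
      * ((C E * (C q₁ * X + C q₀) ^ 2 - C p * (C T₁ * X + C T₀) * (C q₁ * X + C q₀))
        - C Complex.I * (C (p ^ 2) * X + 2 * (C q₁ * X + C q₀) ^ 2))

lemma natDegree_lineEliminant_le (p E q₁ q₀ T₁ T₀ : ℂ) :
    (lineEliminant p E q₁ q₀ T₁ T₀).natDegree ≤ 4 := by
  unfold lineEliminant
  compute_degree

lemma coeff_lineEliminant (p E q₁ q₀ T₁ T₀ : ℂ) :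
    (lineEliminant p E q₁ q₀ T₁ T₀).coeff 4
      = (q₁ * (E * q₁ - T₁ * p + (1 - Complex.I) * q₁)) ^ 2 := by
  have h : (lineEliminant p E q₁ q₀ T₁ T₀).coeff 4
      = 2 * Complex.I * q₁ ^ 4 + (2 * q₁ ^ 2 + (E * q₁ ^ 2 - p * T₁ * q₁))
        * ((E * q₁ ^ 2 - p * T₁ * q₁) - Complex.I * (2 * q₁ ^ 2)) := by
    unfold lineEliminant
    compute_degree
    all_goals simp
  rw [h]
  linear_combination - q₁ ^ 4 * Complex.I_sq

open Polynomial in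
/-- The roots of `ratioPoly` are the ratios `w / z` along which the eliminant degenerates. -/
def ratioPoly (a b : ℂ) : ℂ[X] :=
  (C (1 - a) + C (1 - b) * X)
    * ((1 - X) ^ 2 * (C (1 - a) + C (1 - b) * X)
        - (1 + X) * (C (1 - a / b) + C (1 - b / a) * X ^ 2))

lemma natDegree_ratioPoly_le (a b : ℂ) : (ratioPoly a b).natDegree ≤ 4 := by
  unfold ratioPoly
  compute_degree

open Polynomial in
lemma ratioPoly_ne_zero {a b : ℂ} (ha : a ≠ 0) (hb : b ≠ 0) (hab : ¬(a = 1 ∧ b = 1)) :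
    ratioPoly a b ≠ 0 := by
  unfold ratioPoly
  refine mul_ne_zero (fun h => hab ?_) (fun h => hab ?_)
  · have h0 := congrArg (eval 0) h
    have h1 := congrArg (eval 1) h
    simp at h0 h1
    rw [h0, zero_add] at h1
    exact ⟨(sub_eq_zero.1 h0).symm, (sub_eq_zero.1 h1).symm⟩
  · have h0 := congrArg (eval 0) h
    have h1 := congrArg (eval 1) h
    simp at h0 h1
    have hb1 : b = 1 := by
      field_simp at h0
      apply mul_left_cancel₀ ha
      linear_combination -h0
    subst hb1
    refine ⟨?_, rfl⟩
    have h2 : (a - 1) ^ 2 = 0 := by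
      field_simp at h1
      linear_combination -h1
    exact sub_eq_zero.1 (pow_eq_zero_iff two_ne_zero |>.1 h2)

/-- Along the line `w = z * c`, a shared root makes the line eliminant vanish at `z ^ 2`. -/
lemma eval_lineEliminant_eq_zero {a b z c l : ℂ} (ha : a ≠ 0) (hb : b ≠ 0) (hz : z ≠ 0) (hc : c ≠ 0)
    (h : l ^ 4 - Complex.I + (Complex.I - 1) / 4 * ((z + z * c) ^ 2 / (z * (z * c))) * l ^ 2
      - (z⁻¹ + Complex.I * z + (z * c)⁻¹ + Complex.I * (z * c)) / 2 * (l * (l ^ 2 - 1)) = 0)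
    (h' : l ^ 4 - Complex.I
      + (Complex.I - 1) / 4 * ((z * a + z * c * b) ^ 2 / (z * a * (z * c * b))) * l ^ 2
      - ((z * a)⁻¹ + Complex.I * (z * a) + (z * c * b)⁻¹ + Complex.I * (z * c * b)) / 2
        * (l * (l ^ 2 - 1)) = 0) :
    (lineEliminant ((Complex.I - 1) / 4 * ((1 - a / b) / c + (1 - b / a) * c))
      ((Complex.I - 1) / 4 * (1 + c) ^ 2 / c)
      (Complex.I / 2 * ((1 - a) + (1 - b) * c)) (((1 - a⁻¹) + (1 - b⁻¹) / c) / 2)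
      (Complex.I / 2 * (1 + c)) ((1 + c⁻¹) / 2)).eval (z ^ 2) = 0 := by
  have key := eliminant_eq_zero h h'
  have hE : (Complex.I - 1) / 4 * ((z + z * c) ^ 2 / (z * (z * c)))
      = (Complex.I - 1) / 4 * (1 + c) ^ 2 / c := by
    field_simp
  have hp : (Complex.I - 1) / 4 * ((z + z * c) ^ 2 / (z * (z * c)))
      - (Complex.I - 1) / 4 * ((z * a + z * c * b) ^ 2 / (z * a * (z * c * b)))
      = (Complex.I - 1) / 4 * ((1 - a / b) / c + (1 - b / a) * c) := by
    field_simp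
    ring
  have hT : (z⁻¹ + Complex.I * z + (z * c)⁻¹ + Complex.I * (z * c)) / 2
      = (Complex.I / 2 * (1 + c) * z ^ 2 + (1 + c⁻¹) / 2) / z := by
    field_simp
    ring
  have hq : (z⁻¹ + Complex.I * z + (z * c)⁻¹ + Complex.I * (z * c)) / 2
      - ((z * a)⁻¹ + Complex.I * (z * a) + (z * c * b)⁻¹ + Complex.I * (z * c * b)) / 2
      = (Complex.I / 2 * ((1 - a) + (1 - b) * c) * z ^ 2
          + ((1 - a⁻¹) + (1 - b⁻¹) / c) / 2) / z := by
    field_simp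
    ring
  rw [hp, hq, hE, hT] at key
  unfold lineEliminant
  simp only [Polynomial.eval_add, Polynomial.eval_sub, Polynomial.eval_mul, Polynomial.eval_pow,
    Polynomial.eval_C, Polynomial.eval_X, Polynomial.eval_ofNat]
  generalize (Complex.I - 1) / 4 * ((1 - a / b) / c + (1 - b / a) * c) = p at *
  generalize (Complex.I - 1) / 4 * (1 + c) ^ 2 / c = E at *
  generalize Complex.I / 2 * ((1 - a) + (1 - b) * c) = q₁ at *
  generalize ((1 - a⁻¹) + (1 - b⁻¹) / c) / 2 = q₀ at *
  generalize Complex.I / 2 * (1 + c) = T₁ at *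
  generalize (1 + c⁻¹) / 2 = T₀ at *
  field_simp at key
  linear_combination key

lemma lineEliminant_ne_zero {a b c q₀ T₀ : ℂ} (hc : c ≠ 0)
    (h : (ratioPoly a b).eval c ≠ 0) :
    lineEliminant ((Complex.I - 1) / 4 * ((1 - a / b) / c + (1 - b / a) * c))
      ((Complex.I - 1) / 4 * (1 + c) ^ 2 / c)
      (Complex.I / 2 * ((1 - a) + (1 - b) * c)) q₀ (Complex.I / 2 * (1 + c)) T₀ ≠ 0 := by
  intro h0
  have h1 := coeff_lineEliminant ((Complex.I - 1) / 4 * ((1 - a / b) / c + (1 - b / a) * c))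
      ((Complex.I - 1) / 4 * (1 + c) ^ 2 / c)
      (Complex.I / 2 * ((1 - a) + (1 - b) * c)) q₀ (Complex.I / 2 * (1 + c)) T₀
  rw [h0, Polynomial.coeff_zero, eq_comm, pow_eq_zero_iff two_ne_zero] at h1
  have hI : Complex.I - 1 ≠ 0 := by
    intro h
    have := congrArg Complex.im h
    simp at this
  apply h
  have h2 : (Complex.I / 2) ^ 2 * ((Complex.I - 1) / 4) / c * (ratioPoly a b).eval c = 0 := by
    rw [← h1]
    unfold ratioPoly
    simp only [Polynomial.eval_add, Polynomial.eval_sub, Polynomial.eval_mul, Polynomial.eval_pow,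
      Polynomial.eval_C, Polynomial.eval_X, Polynomial.eval_one]
    generalize a / b = s
    generalize b / a = t
    field_simp
    ring
  have h3 : (Complex.I / 2) ^ 2 * ((Complex.I - 1) / 4) / c ≠ 0 := by
    exact div_ne_zero (mul_ne_zero (pow_ne_zero _ (div_ne_zero Complex.I_ne_zero two_ne_zero))
      (div_ne_zero hI (by norm_num))) hc
  exact (mul_eq_zero.1 h2).resolve_left h3

/-- Pairs in `G ×ˢ G` satisfying a polynomial condition that degenerates only at the roots of `f`
in the first coordinate are few. -/
lemma card_filter_product_le (G : Finset ℂ) (f : Polynomial ℂ) (hf : f ≠ 0)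
    (hf4 : f.natDegree ≤ 4) (g : ℂ → Polynomial ℂ) (hg4 : ∀ c, (g c).natDegree ≤ 4)
    (hg : ∀ c ∈ G, f.eval c ≠ 0 → g c ≠ 0) :
    ((G ×ˢ G).filter fun x : ℂ × ℂ => (g x.1).eval (x.2 ^ 2) = 0).card ≤ 12 * G.card := by
  classical
  have hsub : (G ×ˢ G).filter (fun x : ℂ × ℂ => (g x.1).eval (x.2 ^ 2) = 0) ⊆
      (f.roots.toFinset ×ˢ G) ∪ G.biUnion fun c =>
        {c} ×ˢ (Polynomial.expand ℂ 2 (g c)).roots.toFinset := by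
    rintro ⟨c, z⟩ hx
    simp only [Finset.mem_filter, Finset.mem_product] at hx
    obtain ⟨⟨hc, hz⟩, h0⟩ := hx
    rw [Finset.mem_union]
    by_cases hfc : f.eval c = 0
    · left
      simp [hf, hfc, hz]
    · right
      rw [Finset.mem_biUnion]
      refine ⟨c, hc, ?_⟩
      have := hg c hc hfc
      simp [Polynomial.expand_eq_zero, this, Polynomial.expand_eval, h0]
  have h1 : (f.roots.toFinset ×ˢ G).card ≤ 4 * G.card := by
    rw [Finset.card_product]
    gcongr
    exact (Multiset.toFinset_card_le _).trans ((Polynomial.card_roots' _).trans hf4)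
  have h2 : (G.biUnion fun c =>
      {c} ×ˢ (Polynomial.expand ℂ 2 (g c)).roots.toFinset).card ≤ G.card * 8 := by
    refine Finset.card_biUnion_le_card_mul _ _ _ fun c _ => ?_
    rw [Finset.card_product, Finset.card_singleton, one_mul]
    refine (Multiset.toFinset_card_le _).trans ((Polynomial.card_roots' _).trans ?_)
    rw [Polynomial.natDegree_expand]
    have := hg4 c
    omega
  have h3 := (Finset.card_le_card hsub).trans (Finset.card_union_le _ _)
  omega

lemma ncard_common_spectrum_le {N : ℕ} (m : Fin 2 → ℕ) (hm : ∀ l, m l < N) (hm0 : m ≠ 0) :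
    Set.ncard {r : Fin 2 → Fin N |
      (spectrum ℂ (fourierFloquet fun l => (((r l : ℕ) + m l : ℕ) : ℝ) / (N : ℝ)) ∩
       spectrum ℂ (fourierFloquet fun l => ((r l : ℕ) : ℝ) / (N : ℝ))).Nonempty} ≤ 12 * N := by
  have hN : N ≠ 0 := Nat.ne_zero_of_lt (hm 0)
  obtain ⟨a, ha⟩ : ∃ a, a = ee ((m 0 : ℝ) / N) := ⟨_, rfl⟩
  obtain ⟨b, hb⟩ : ∃ b, b = ee ((m 1 : ℝ) / N) := ⟨_, rfl⟩
  have ha0 : a ≠ 0 := ha ▸ ee_ne_zero _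
  have hb0 : b ≠ 0 := hb ▸ ee_ne_zero _
  have hab : ¬(a = 1 ∧ b = 1) := by
    rintro ⟨ha1, hb1⟩
    apply hm0
    ext l
    fin_cases l
    · exact ee_natCast_div_eq_one (hm 0) (ha ▸ ha1)
    · exact ee_natCast_div_eq_one (hm 1) (hb ▸ hb1)
  have hGmem : ∀ k : ℕ, ee ((k : ℝ) / N) ∈ Polynomial.nthRootsFinset N (1 : ℂ) := fun k =>
    (Polynomial.mem_nthRootsFinset (Nat.pos_of_ne_zero hN) 1).2 (ee_natCast_div_pow hN k)
  have hGcard : (Polynomial.nthRootsFinset N (1 : ℂ)).card ≤ N := by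
    classical
    rw [Polynomial.nthRootsFinset_def]
    exact (Multiset.toFinset_card_le _).trans (Polynomial.card_nthRoots _ _)
  have hcount := card_filter_product_le (Polynomial.nthRootsFinset N (1 : ℂ)) (ratioPoly a b)
    (ratioPoly_ne_zero ha0 hb0 hab) (natDegree_ratioPoly_le a b)
    (fun c => lineEliminant ((Complex.I - 1) / 4 * ((1 - a / b) / c + (1 - b / a) * c))
      ((Complex.I - 1) / 4 * (1 + c) ^ 2 / c)
      (Complex.I / 2 * ((1 - a) + (1 - b) * c)) (((1 - a⁻¹) + (1 - b⁻¹) / c) / 2)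
      (Complex.I / 2 * (1 + c)) ((1 + c⁻¹) / 2))
    (fun c => natDegree_lineEliminant_le _ _ _ _ _ _)
    (fun c hc h => lineEliminant_ne_zero
      (Polynomial.ne_zero_of_mem_nthRootsFinset one_ne_zero hc) h)
  refine le_trans ?_ (hcount.trans (Nat.mul_le_mul_left 12 hGcard))
  rw [← Set.ncard_coe_finset]
  refine Set.ncard_le_ncard_of_injOn
    (fun r => (ee (((r 1 : ℕ) : ℝ) / N) / ee (((r 0 : ℕ) : ℝ) / N), ee (((r 0 : ℕ) : ℝ) / N)))
    ?_ ?_ (Finset.finite_toSet _)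
  · rintro r ⟨l, hl', hl⟩
    obtain ⟨z, hz⟩ : ∃ z, z = ee (((r 0 : ℕ) : ℝ) / N) := ⟨_, rfl⟩
    obtain ⟨w, hw⟩ : ∃ w, w = ee (((r 1 : ℕ) : ℝ) / N) := ⟨_, rfl⟩
    have hz0 : z ≠ 0 := hz ▸ ee_ne_zero _
    have hw0 : w ≠ 0 := hw ▸ ee_ne_zero _
    have hzm := hGmem (r 0)
    have hwm := hGmem (r 1)
    rw [← hz, Polynomial.mem_nthRootsFinset (Nat.pos_of_ne_zero hN)] at hzm
    rw [← hw, Polynomial.mem_nthRootsFinset (Nat.pos_of_ne_zero hN)] at hwm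
    have hzw : z * (w / z) = w := by field_simp
    have h := charpoly_eq_zero_of_mem_spectrum hz.symm (hw.symm.trans hzw.symm) hl
    have h' := charpoly_eq_zero_of_mem_spectrum (z := z * a) (w := z * (w / z) * b)
      (by rw [hz, ha, ← ee_add]; congr 1; push_cast; ring)
      (by rw [hzw, hw, hb, ← ee_add]; congr 1; push_cast; ring) hl'
    simp only [Finset.coe_filter, Set.mem_ofPred_eq, Finset.mem_product, ← hz, ← hw,
      Polynomial.mem_nthRootsFinset (Nat.pos_of_ne_zero hN)]
    exact ⟨⟨by rw [div_pow, hzm, hwm, div_one], hzm⟩,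
      eval_lineEliminant_eq_zero ha0 hb0 hz0 (div_ne_zero hw0 hz0) h h'⟩
  · intro r _ s _ hrs
    simp only [Prod.mk.injEq] at hrs
    obtain ⟨h1, h0⟩ := hrs
    rw [h0, div_left_inj' (ee_ne_zero _)] at h1
    ext l
    fin_cases l
    · exact congrArg Fin.val (ee_natCast_div_injective N h0)
    · exact congrArg Fin.val (ee_natCast_div_injective N h1)

/-- **NRG for the 2d Fourier-coined quantum walk.** -/
theorem fourier_walk_NRG : SpectralNRG 2 fourierFloquet := by
  intro ε hε
  obtain ⟨N₀, hN₀⟩ := exists_nat_gt (12 / ε)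
  refine ⟨N₀, fun N hN m hm hm0 => ?_⟩
  have hNpos : (0 : ℝ) < N := by exact_mod_cast Nat.zero_lt_of_lt (hm 0)
  have hcount := ncard_common_spectrum_le m hm hm0
  have hlt : 12 < ε * N := by
    rw [div_lt_iff₀ hε] at hN₀
    have : (N₀ : ℝ) ≤ N := by exact_mod_cast hN
    nlinarith
  rw [div_lt_iff₀ (by positivity)]
  calc _ ≤ ((12 * N : ℕ) : ℝ) := by exact_mod_cast hcount
    _ = 12 * N := by push_cast; ring
    _ < ε * N * N := by gcongr
    _ = ε * (N : ℝ) ^ 2 := by ring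

end QW
end
end

section
/- Let d ≥ 2, n ≥ 1 and let Û : ℝ^d → M_n(ℂ) be a matrix-valued function such that every entry has the form Û(θ)_{i,j} = Σ_{x ∈ {−1,1}^d} u(i,j,x)·exp(2πi x·θ) for some coefficients u(i,j,x) ∈ ℂ. Then Û(θ + v) = Û(θ) for every θ ∈ ℝ^d, where v = (1/2, 1/2, 0, …, 0). Consequently, for every even N ≥ 2, taking m = (N/2, N/2, 0, …, 0) ∈ {0,…,N−1}^d, one has Û((r+m)/N) = Û(r/N), hence spectrum(Û((r+m)/N)) = spectrum(Û(r/N)), for every r ∈ {0,…,N−1}^d; thus the spectral NRG fraction equals 1 for every even N and the spectral NRG condition fails for Û. -/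
open Filter

noncomputable section

namespace QW

/-- The half-period shift in the first two coordinates pairs with `x ∈ {−1,1}^d` to an integer. -/
lemma exists_int_sum_mul_half {d : ℕ} (hd : 2 ≤ d) (x : Fin d → ℤ)
    (hx : ∀ l, x l = -1 ∨ x l = 1) :
    ∃ k : ℤ, ∑ l, (x l : ℝ) * (if (l : ℕ) ≤ 1 then (1 / 2 : ℝ) else 0) = k := by
  obtain ⟨d, rfl⟩ := Nat.exists_eq_add_of_le' hd
  simp only [Fin.sum_univ_succ]
  rcases hx 0 with h0 | h0 <;> rcases hx 1 with h1 | h1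
  · exact ⟨-1, by simp [h0, h1]; norm_num⟩
  · exact ⟨0, by simp [h0, h1]⟩
  · exact ⟨0, by simp [h0, h1]⟩
  · exact ⟨1, by simp [h0, h1]; norm_num⟩

lemma natCast_add_half_div (a N : ℕ) (hN : 2 ≤ N) (hdvd : 2 ∣ N) (p : Prop) [Decidable p] :
    ((a + (if p then N / 2 else 0) : ℕ) : ℝ) / (N : ℝ) =
      (a : ℝ) / (N : ℝ) + (if p then (1 / 2 : ℝ) else 0) := by
  have hN0 : (N : ℝ) ≠ 0 := by positivity
  split_ifs
  · rw [Nat.cast_add, Nat.cast_div hdvd (by norm_num)]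
    push_cast
    field_simp
  · simp

/-- **Separable walks with jumps `±1` violate NRG.** If every entry of `Û(θ)` is a
trigonometric polynomial supported on frequencies `x ∈ {−1,1}^d`, then `Û` is periodic
under the shift `v = (1/2, 1/2, 0, …, 0)`; hence for every even `N` and
`m = (N/2, N/2, 0, …, 0)` one has `Û((r+m)/N) = Û(r/N)` for all `r`, the spectral NRG
fraction equals `1`, and the spectral NRG condition fails. -/
theorem separable_walk_NRG_fails
    {d n : ℕ} (hd : 2 ≤ d) (hn : 1 ≤ n)
    (U : (Fin d → ℝ) → Matrix (Fin n) (Fin n) ℂ)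
    (u : Fin n → Fin n → (Fin d → ℤ) → ℂ)
    (hU : ∀ (θ : Fin d → ℝ) (i j : Fin n),
      U θ i j = ∑ x ∈ Fintype.piFinset (fun _ : Fin d => ({-1, 1} : Finset ℤ)),
        u i j x * Complex.exp (2 * Real.pi * Complex.I * ((∑ l, (x l : ℝ) * θ l : ℝ) : ℂ))) :
    (∀ θ : Fin d → ℝ,
        U (fun l => θ l + (if (l : ℕ) ≤ 1 then (1 / 2 : ℝ) else 0)) = U θ)
    ∧ (∀ N : ℕ, 2 ≤ N → 2 ∣ N → ∀ r : Fin d → Fin N,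
        (U (fun l => (((r l : ℕ) + (if (l : ℕ) ≤ 1 then N / 2 else 0) : ℕ) : ℝ) / (N : ℝ))
          = U (fun l => ((r l : ℕ) : ℝ) / (N : ℝ)))
        ∧ spectrum ℂ
            (U (fun l => (((r l : ℕ) + (if (l : ℕ) ≤ 1 then N / 2 else 0) : ℕ) : ℝ) / (N : ℝ)))
          = spectrum ℂ (U (fun l => ((r l : ℕ) : ℝ) / (N : ℝ))))
    ∧ (∀ N : ℕ, 2 ≤ N → 2 ∣ N →
        ((Set.ncard {r : Fin d → Fin N |
          (spectrum ℂ
              (U fun l => (((r l : ℕ) + (if (l : ℕ) ≤ 1 then N / 2 else 0) : ℕ) : ℝ) / (N : ℝ)) ∩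
           spectrum ℂ (U fun l => ((r l : ℕ) : ℝ) / (N : ℝ))).Nonempty}) : ℝ) / (N : ℝ) ^ d = 1)
    ∧ ¬ SpectralNRG d U := by
  have period (θ : Fin d → ℝ) :
      U (fun l => θ l + (if (l : ℕ) ≤ 1 then (1 / 2 : ℝ) else 0)) = U θ := by
    ext i j
    rw [hU, hU]
    refine Finset.sum_congr rfl fun x hx => ?_
    obtain ⟨k, hk⟩ := exists_int_sum_mul_half hd x fun l => by
      simpa using Fintype.mem_piFinset.mp hx l
    simp only [mul_add, Finset.sum_add_distrib, hk]
    congr 1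
    rw [Complex.exp_eq_exp_iff_exists_int]
    exact ⟨k, by push_cast; ring⟩
  have grid (N : ℕ) (hN : 2 ≤ N) (hdvd : 2 ∣ N) (r : Fin d → Fin N) :
      U (fun l => (((r l : ℕ) + (if (l : ℕ) ≤ 1 then N / 2 else 0) : ℕ) : ℝ) / (N : ℝ))
        = U (fun l => ((r l : ℕ) : ℝ) / (N : ℝ)) := by
    simp only [natCast_add_half_div _ N hN hdvd]
    exact period _
  have fraction (N : ℕ) (hN : 2 ≤ N) (hdvd : 2 ∣ N) :
      ((Set.ncard {r : Fin d → Fin N |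
        (spectrum ℂ
            (U fun l => (((r l : ℕ) + (if (l : ℕ) ≤ 1 then N / 2 else 0) : ℕ) : ℝ) / (N : ℝ)) ∩
          spectrum ℂ (U fun l => ((r l : ℕ) : ℝ) / (N : ℝ))).Nonempty}) : ℝ) / (N : ℝ) ^ d = 1 := by
    have : Nonempty (Fin n) := ⟨⟨0, hn⟩⟩
    have hne (A : Matrix (Fin n) (Fin n) ℂ) : (spectrum ℂ A).Nonempty :=
      spectrum.nonempty_of_isAlgClosed_of_finiteDimensional ℂ A
    have hN0 : (N : ℝ) ≠ 0 := by positivity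
    simp only [grid N hN hdvd, Set.inter_self, hne, Set.ofPred_true, Set.ncard_univ]
    simp [hN0]
  refine ⟨period, fun N hN hdvd r => ⟨grid N hN hdvd r, by rw [grid N hN hdvd r]⟩, fraction, ?_⟩
  intro h
  obtain ⟨N₀, hN₀⟩ := h 1 one_pos
  refine (hN₀ (2 * (N₀ + 1)) (by omega)
    (fun l => if (l : ℕ) ≤ 1 then 2 * (N₀ + 1) / 2 else 0) (fun l => ?_) fun h0 => ?_).ne
    (fraction _ (by omega) (by omega))
  · split_ifs <;> omega
  · have := congrFun h0 ⟨0, by omega⟩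
    simp at this

end QW
end
end

section
/- Let Û_H(θ) = (1/√2)·[[exp(2πi θ), exp(2πi θ)],[exp(−2πi θ), −exp(−2πi θ)]] be the Floquet matrix of the Hadamard walk on ℤ and Û_G(θ) = (1/3)·[[−exp(2πi θ), 2·exp(2πi θ), 2·exp(2πi θ)],[2, −1, 2],[2·exp(−2πi θ), 2·exp(−2πi θ), −exp(−2πi θ)]] be the Floquet matrix of the Grover walk on ℤ, and consider the two-dimensional Floquet matrix Û(θ₁,θ₂) = Û_H(θ₁) ⊗ Û_G(θ₂) (Kronecker product) of the tensor walk U_H ⊗ U_G on ℤ². Then 1 ∈ spectrum(Û_G(θ)) for every θ ∈ ℝ (the Grover walk has a flat band), and consequently, for every N ≥ 2 and every r ∈ {0,…,N−1}², spectrum(Û(r₁/N, (r₂+1)/N)) ∩ spectrum(Û(r₁/N, r₂/N)) ≠ ∅; hence, taking m = (0,1), the spectral NRG fraction equals 1 for every N ≥ 2, so no strictly increasing sequence (N_n) of integers satisfies the spectral NRG condition for Û. -/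
open Filter Kronecker

noncomputable section

namespace QW

/-- Floquet matrix of the Hadamard walk on `ℤ`. -/
def hadamardFloquet (θ : ℝ) : Matrix (Fin 2) (Fin 2) ℂ :=
  ((Real.sqrt 2 : ℝ) : ℂ)⁻¹ •
    (!![Complex.exp (2 * Real.pi * Complex.I * (θ : ℂ)),
        Complex.exp (2 * Real.pi * Complex.I * (θ : ℂ));
        Complex.exp (-(2 * Real.pi * Complex.I) * (θ : ℂ)),
        -Complex.exp (-(2 * Real.pi * Complex.I) * (θ : ℂ))] : Matrix (Fin 2) (Fin 2) ℂ)

/-- Floquet matrix of the Grover walk on `ℤ`. -/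
def groverFloquet (θ : ℝ) : Matrix (Fin 3) (Fin 3) ℂ :=
  (3 : ℂ)⁻¹ •
    (!![-Complex.exp (2 * Real.pi * Complex.I * (θ : ℂ)),
        2 * Complex.exp (2 * Real.pi * Complex.I * (θ : ℂ)),
        2 * Complex.exp (2 * Real.pi * Complex.I * (θ : ℂ));
        2, -1, 2;
        2 * Complex.exp (-(2 * Real.pi * Complex.I) * (θ : ℂ)),
        2 * Complex.exp (-(2 * Real.pi * Complex.I) * (θ : ℂ)),
        -Complex.exp (-(2 * Real.pi * Complex.I) * (θ : ℂ))] : Matrix (Fin 3) (Fin 3) ℂ)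

/-- Floquet matrix of the tensor walk `U_H ⊗ U_G` on `ℤ²` (Kronecker product). -/
def hadamardGroverFloquet (θ : Fin 2 → ℝ) : Matrix (Fin 2 × Fin 3) (Fin 2 × Fin 3) ℂ :=
  hadamardFloquet (θ 0) ⊗ₖ groverFloquet (θ 1)

/-- Spectral "No Repeating Graphs" condition along a sequence `(N_n)`, for a
two-dimensional Floquet matrix. -/
def SpectralNRGAlong {ι : Type*} [Fintype ι] [DecidableEq ι]
    (U : (Fin 2 → ℝ) → Matrix ι ι ℂ) (Ns : ℕ → ℕ) : Prop :=
  ∀ ε : ℝ, 0 < ε → ∃ n₀ : ℕ, ∀ n : ℕ, n₀ ≤ n → ∀ m : Fin 2 → ℕ,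
    (∀ l, m l < Ns n) → m ≠ 0 →
    ((Set.ncard {r : Fin 2 → Fin (Ns n) |
      (spectrum ℂ (U fun l => (((r l : ℕ) + m l : ℕ) : ℝ) / ((Ns n : ℕ) : ℝ)) ∩
       spectrum ℂ (U fun l => ((r l : ℕ) : ℝ) / ((Ns n : ℕ) : ℝ))).Nonempty}) : ℝ)
      / ((Ns n : ℕ) : ℝ) ^ 2 < ε

theorem _root_.Matrix.mem_spectrum_iff_exists_mulVec {ι K : Type*} [Fintype ι] [DecidableEq ι]
    [Field K] {A : Matrix ι ι K} {μ : K} :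
    μ ∈ spectrum K A ↔ ∃ v : ι → K, v ≠ 0 ∧ A.mulVec v = μ • v := by
  rw [spectrum.mem_iff, Matrix.isUnit_iff_isUnit_det, isUnit_iff_ne_zero, not_not,
    ← Matrix.exists_mulVec_eq_zero_iff]
  simp only [Algebra.algebraMap_eq_smul_one, Matrix.sub_mulVec, Matrix.smul_mulVec,
    Matrix.one_mulVec, sub_eq_zero, eq_comm (a := μ • _)]

theorem _root_.Matrix.mul_mem_spectrum_kronecker {ι κ K : Type*} [Fintype ι] [DecidableEq ι]
    [Fintype κ] [DecidableEq κ] [Field K] {A : Matrix ι ι K} {B : Matrix κ κ K} {μ ν : K}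
    (hμ : μ ∈ spectrum K A) (hν : ν ∈ spectrum K B) : μ * ν ∈ spectrum K (A ⊗ₖ B) := by
  rw [Matrix.mem_spectrum_iff_exists_mulVec] at hμ hν ⊢
  obtain ⟨u, hu, hAu⟩ := hμ
  obtain ⟨w, hw, hBw⟩ := hν
  obtain ⟨i, hi⟩ := Function.ne_iff.mp hu
  obtain ⟨j, hj⟩ := Function.ne_iff.mp hw
  refine ⟨fun p => u p.1 * w p.2, Function.ne_iff.mpr ⟨(i, j), mul_ne_zero hi hj⟩, ?_⟩
  ext ⟨a, b⟩
  have hA : ∑ x, A a x * u x = μ * u a := congrFun hAu a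
  have hB : ∑ y, B b y * w y = ν * w b := congrFun hBw b
  calc ∑ p : ι × κ, A a p.1 * B b p.2 * (u p.1 * w p.2)
      = (∑ x, A a x * u x) * ∑ y, B b y * w y := by
        rw [Fintype.sum_prod_type, Finset.sum_mul_sum]
        exact Finset.sum_congr rfl fun x _ => Finset.sum_congr rfl fun y _ => by ring
    _ = μ * ν * (u a * w b) := by rw [hA, hB]; ring

/-- The Grover walk has the flat band `1`. -/
theorem one_mem_spectrum_groverFloquet (θ : ℝ) : (1 : ℂ) ∈ spectrum ℂ (groverFloquet θ) := by
  have h : Complex.exp (2 * Real.pi * Complex.I * (θ : ℂ)) *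
      Complex.exp (-(2 * Real.pi * Complex.I) * (θ : ℂ)) = 1 := by
    rw [← Complex.exp_add, neg_mul, add_neg_cancel, Complex.exp_zero]
  rw [spectrum.mem_iff, Matrix.isUnit_iff_isUnit_det, isUnit_iff_ne_zero, not_not, groverFloquet,
    map_one]
  generalize Complex.exp (2 * Real.pi * Complex.I * (θ : ℂ)) = a at *
  generalize Complex.exp (-(2 * Real.pi * Complex.I) * (θ : ℂ)) = b at *
  simp [Matrix.det_fin_three]
  grind

/-- The flat band of the Grover factor makes the spectra meet at any two momenta with the same
first coordinate. -/
theorem spectrum_hadamardGroverFloquet_inter_nonempty {θ θ' : Fin 2 → ℝ} (h : θ 0 = θ' 0) :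
    (spectrum ℂ (hadamardGroverFloquet θ) ∩ spectrum ℂ (hadamardGroverFloquet θ')).Nonempty := by
  obtain ⟨μ, hμ⟩ :=
    spectrum.nonempty_of_isAlgClosed_of_finiteDimensional ℂ (hadamardFloquet (θ 0))
  exact ⟨μ * 1, Matrix.mul_mem_spectrum_kronecker hμ (one_mem_spectrum_groverFloquet _),
    Matrix.mul_mem_spectrum_kronecker (h ▸ hμ) (one_mem_spectrum_groverFloquet _)⟩

/-- The spectral NRG fraction for the shift `m` is `1` when `m` has zero first coordinate. -/
theorem hadamardGroverFloquet_NRG_fraction_eq_one {N : ℕ} (hN : N ≠ 0) (m : Fin 2 → ℕ)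
    (hm : m 0 = 0) :
    ((Set.ncard {r : Fin 2 → Fin N |
      (spectrum ℂ (hadamardGroverFloquet fun l => (((r l : ℕ) + m l : ℕ) : ℝ) / (N : ℝ)) ∩
       spectrum ℂ (hadamardGroverFloquet fun l => ((r l : ℕ) : ℝ) / (N : ℝ))).Nonempty}) : ℝ)
      / (N : ℝ) ^ 2 = 1 := by
  have h (r : Fin 2 → Fin N) := spectrum_hadamardGroverFloquet_inter_nonempty
    (θ := fun l => (((r l : ℕ) + m l : ℕ) : ℝ) / (N : ℝ))
    (θ' := fun l => ((r l : ℕ) : ℝ) / (N : ℝ)) (by simp [hm])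
  simp only [h, Set.ofPred_true, Set.ncard_univ]
  simp [hN]

/-- **The tensor walk `U_H ⊗ U_G` admits no subsequence satisfying NRG.** The Grover
walk has the flat band `1`, hence the spectra of `Û` at `(r₁/N, (r₂+1)/N)` and
`(r₁/N, r₂/N)` always intersect, the NRG fraction equals `1` for every `N ≥ 2`, and no
strictly increasing sequence of integers satisfies the spectral NRG condition. -/
theorem hadamard_grover_no_NRG_subsequence :
    (∀ θ : ℝ, (1 : ℂ) ∈ spectrum ℂ (groverFloquet θ))
    ∧ (∀ N : ℕ, 2 ≤ N → ∀ r₁ r₂ : Fin N,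
        (spectrum ℂ (hadamardGroverFloquet
            ![((r₁ : ℕ) : ℝ) / (N : ℝ), (((r₂ : ℕ) + 1 : ℕ) : ℝ) / (N : ℝ)]) ∩
         spectrum ℂ (hadamardGroverFloquet
            ![((r₁ : ℕ) : ℝ) / (N : ℝ), ((r₂ : ℕ) : ℝ) / (N : ℝ)])).Nonempty)
    ∧ (∀ N : ℕ, 2 ≤ N →
        ((Set.ncard {r : Fin 2 → Fin N |
          (spectrum ℂ (hadamardGroverFloquet
              fun l => (((r l : ℕ) + (if l = 0 then 0 else 1) : ℕ) : ℝ) / (N : ℝ)) ∩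
           spectrum ℂ (hadamardGroverFloquet
              fun l => ((r l : ℕ) : ℝ) / (N : ℝ))).Nonempty}) : ℝ) / (N : ℝ) ^ 2 = 1)
    ∧ ¬ ∃ Ns : ℕ → ℕ, StrictMono Ns ∧ SpectralNRGAlong hadamardGroverFloquet Ns := by
  refine ⟨one_mem_spectrum_groverFloquet,
    fun N _ r₁ r₂ => spectrum_hadamardGroverFloquet_inter_nonempty (by simp),
    fun N hN => hadamardGroverFloquet_NRG_fraction_eq_one (by omega)
      (fun l => if l = 0 then 0 else 1) (by simp), ?_⟩
  rintro ⟨Ns, hNs, hNRG⟩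
  obtain ⟨n₀, h⟩ := hNRG 1 one_pos
  have hn : 2 ≤ Ns (n₀ + 2) := (Nat.le_add_left 2 n₀).trans (hNs.id_le _)
  refine (h (n₀ + 2) (by omega) ![0, 1] ?_ (by simp)).ne
    (hadamardGroverFloquet_NRG_fraction_eq_one (by omega) ![0, 1] (by simp))
  intro l
  fin_cases l <;> simp <;> omega

end QW
end
end
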